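/- Let (G, Ω_G) and (F, Ω_F) be two finite holomorphic IFS on ℂ satisfying the strong separation condition, where G = {g_i}_{i∈Λ} and F = {f_j}_{j∈Λ̃}. Then the following are equivalent: (I) G and F share the same attractor A = A_G = A_F; (II) there exist a finite collection of words w^k ∈ Λ*, v^k ∈ Λ̃*, k = 1, …, k₀, for some k₀ ∈ ℕ, and m₀ ∈ ℕ, such that: (G-side) for some ball B_G ⊂ Ω_G, for every m ≥ m₀ and every w ∈ Λ^m there exist v ∈ Λ̃* and an index k ∈ {1, …, k₀} with f_v ∘ f_{v^k}^{-1} = g_w ∘ g_{w^k}^{-1} identically on g_{w^k}(B_G), both sides being well-defined there; and (F-side) the same holds after switching the roles of G and F. Moreover, if A_G = A_F then the balls B_G = B_F can be chosen to be one and the same neighborhood of a point of the common attractor A. -/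

import Mathlib

open Set Metric

noncomputable section

/-- A finite holomorphic IFS: a bounded domain `Ω ⊂ ℂ` together with finitely many
univalent maps `g i : Ω → Ω` with `closure (g i '' Ω) ⊆ Ω`. -/
structure HolIFS where
  /-- the number of maps -/
  m : ℕ
  hm : 1 ≤ m
  /-- the domain -/
  Ω : Set ℂ
  hopen : IsOpen Ω
  hconn : IsConnected Ω
  hbdd : Bornology.IsBounded Ω
  /-- the maps of the IFS -/
  g : Fin m → ℂ → ℂ
  hdiff : ∀ i, DifferentiableOn ℂ (g i) Ω
  hinj : ∀ i, Set.InjOn (g i) Ω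
  hcl : ∀ i, closure (g i '' Ω) ⊆ Ω

/-- `A` is the attractor of the IFS `S`: the (unique) nonempty compact subset of `Ω`
with `A = ⋃ i, g i '' A`. -/
def HolIFS.IsAttractor (S : HolIFS) (A : Set ℂ) : Prop :=
  A.Nonempty ∧ IsCompact A ∧ A ⊆ S.Ω ∧ A = ⋃ i, S.g i '' A

/-- The strong separation condition for the IFS `S` with attractor `A`. -/
def HolIFS.SSC (S : HolIFS) (A : Set ℂ) : Prop :=
  ∀ i j : Fin S.m, i ≠ j → Disjoint (S.g i '' A) (S.g j '' A)

/-- For a finite word `w = [i₁, …, i_k]`, the composition `g_w = g i₁ ∘ ⋯ ∘ g i_k`. -/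
def HolIFS.word (S : HolIFS) (w : List (Fin S.m)) : ℂ → ℂ :=
  w.foldr (fun i f => S.g i ∘ f) id

/-- The functional equation `f_v ∘ f_{vk}⁻¹ = g_w ∘ g_{wk}⁻¹` holds on `g_{wk}(B)`, both
sides being well-defined: for every `x ∈ B` there is `y ∈ Ω_F` with
`f_{vk} y = g_{wk} x` (so that `y = f_{vk}⁻¹ (g_{wk} x)`) and `f_v y = g_w x`. -/
def EqOnSet (G F : HolIFS) (B : Set ℂ)
    (wk : List (Fin G.m)) (vk : List (Fin F.m))
    (w : List (Fin G.m)) (v : List (Fin F.m)) : Prop :=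
  ∀ x ∈ B, ∃ y ∈ F.Ω, F.word vk y = G.word wk x ∧ F.word v y = G.word w x

/-- The condition (G) of (II) on a given ball `B = B_G`: for every `m ≥ m₀` and every word
`w ∈ Λ^m` there exist `v ∈ Λ̃*` and `k` such that
`f_v ∘ f_{v^k}⁻¹ = g_w ∘ g_{w^k}⁻¹` on `g_{w^k}(B)`. -/
def GSide (G F : HolIFS) (k₀ : ℕ) (wk : Fin k₀ → List (Fin G.m))
    (vk : Fin k₀ → List (Fin F.m)) (m₀ : ℕ) (B : Set ℂ) : Prop :=
  ∀ m : ℕ, m₀ ≤ m → ∀ w : List (Fin G.m), w.length = m →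
    ∃ (v : List (Fin F.m)) (k : Fin k₀), v ≠ [] ∧ EqOnSet G F B (wk k) (vk k) w v

open Filter Topology

/-! ### Analysis lemmas -/

theorem injOn_deriv_ne_zero {f : ℂ → ℂ} {U : Set ℂ} (hU : IsOpen U)
    (hf : DifferentiableOn ℂ f U) (hinj : Set.InjOn f U) {a : ℂ} (ha : a ∈ U) :
    deriv f a ≠ 0 := by
  intro hd
  have hUa : U ∈ 𝓝 a := hU.mem_nhds ha
  have hfa : AnalyticAt ℂ f a := hf.analyticAt hUa
  have hF : AnalyticAt ℂ (fun z => f z - f a) a := hfa.sub analyticAt_const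
  have hne : ¬ ∀ᶠ z in 𝓝 a, f z - f a = 0 := by
    intro h
    have h2 : ∀ᶠ z in 𝓝 a, z = a := by
      filter_upwards [h, hUa] with z hz hzU
      exact hinj hzU ha (sub_eq_zero.1 hz)
    have h3 : ∀ᶠ z in 𝓝[≠] a, False := by
      filter_upwards [mem_nhdsWithin_of_mem_nhds h2, self_mem_nhdsWithin] with z h1 h2
      exact h2 h1
    exact (NormedField.nhdsNE_neBot a).ne (by simpa using h3)
  obtain ⟨n, g, hg, hg0, heq⟩ := hF.exists_eventuallyEq_pow_smul_nonzero_iff.2 hne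
  have hn0 : n ≠ 0 := by
    rintro rfl
    have := heq.self_of_nhds
    simp at this
    exact hg0 this.symm
  obtain ⟨c, hc⟩ := IsAlgClosed.exists_pow_nat_eq (g a) (Nat.pos_of_ne_zero hn0)
  have hc0 : c ≠ 0 := by
    rintro rfl
    rw [zero_pow hn0] at hc
    exact hg0 hc.symm
  set φ : ℂ → ℂ := fun z => (z - a) * (c * Complex.exp (Complex.log (g z / g a) / n)) with hφ
  have hψ : AnalyticAt ℂ (fun z => c * Complex.exp (Complex.log (g z / g a) / n)) a := by
    refine analyticAt_const.mul ?_
    refine AnalyticAt.cexp ?_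
    refine AnalyticAt.div ?_ analyticAt_const (by exact_mod_cast hn0)
    refine AnalyticAt.clog (hg.div analyticAt_const hg0) ?_
    rw [div_self hg0]
    exact Complex.one_mem_slitPlane
  have hφa : AnalyticAt ℂ φ a := (analyticAt_id.sub analyticAt_const).mul hψ
  have hφd : HasDerivAt φ c a := by
    have h1 : HasDerivAt (fun z : ℂ => z - a) 1 a := (hasDerivAt_id a).sub_const a
    have := h1.mul hψ.differentiableAt.hasDerivAt
    have h2 : (1 * (c * Complex.exp (Complex.log (g a / g a) / n)) + (a - a) *
        deriv (fun z => c * Complex.exp (Complex.log (g z / g a) / n)) a) = c := by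
      simp [div_self hg0]
    rw [h2] at this
    exact this
  have hφs : HasStrictDerivAt φ c a := by
    have := hφa.hasStrictDerivAt
    rwa [hφd.deriv] at this
  have hφ0 : φ a = 0 := by simp [hφ]
  have hpow : ∀ᶠ z in 𝓝 a, f z - f a = φ z ^ n := by
    have hgc : ∀ᶠ z in 𝓝 a, g z ≠ 0 := hg.continuousAt.eventually_ne hg0
    filter_upwards [heq, hgc] with z hz hgz
    rw [hz, hφ]
    simp only [smul_eq_mul]
    rw [mul_pow, mul_pow, hc, ← Complex.exp_nat_mul, mul_div_cancel₀ _ (by exact_mod_cast hn0),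
      Complex.exp_log (div_ne_zero hgz hg0), mul_div_cancel₀ _ hg0]
  by_cases hn1 : n = 1
  · subst hn1
    have h1 : f =ᶠ[𝓝 a] fun z => φ z + f a := by
      filter_upwards [hpow] with z hz
      rw [pow_one] at hz
      rw [← hz]; ring
    rw [h1.deriv_eq, (hφd.add_const (f a)).deriv] at hd
    exact hc0 hd
  · have hmap := hφs.map_nhds_eq hc0
    set S : Set ℂ := {z | z ∈ U ∧ f z - f a = φ z ^ n}
    have hS : S ∈ 𝓝 a := by
      filter_upwards [hpow, hUa] with z h1 h2 using ⟨h2, h1⟩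
    have hSi : φ '' S ∈ 𝓝 (0 : ℂ) := by
      rw [← hφ0, ← hmap]; exact image_mem_map hS
    have hprim := Complex.isPrimitiveRoot_exp n hn0
    set ζ := Complex.exp (2 * Real.pi * Complex.I / n)
    have hζ1 : ζ ≠ 1 := hprim.ne_one (by omega)
    have hT : Tendsto (fun t : ℂ => ζ * t) (𝓝 0) (𝓝 0) := by
      have : Continuous (fun t : ℂ => ζ * t) := by fun_prop
      simpa using this.tendsto 0
    have hev : ∀ᶠ t in 𝓝[≠] (0 : ℂ), t ∈ φ '' S ∧ ζ * t ∈ φ '' S ∧ t ≠ 0 := by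
      filter_upwards [mem_nhdsWithin_of_mem_nhds hSi, mem_nhdsWithin_of_mem_nhds (hT hSi),
        self_mem_nhdsWithin] with t h1 h2 h3 using ⟨h1, h2, h3⟩
    obtain ⟨t, ⟨z1, hz1, e1⟩, ⟨z2, hz2, e2⟩, ht⟩ := hev.exists
    have : f z1 = f z2 := by
      have a1 := hz1.2
      have a2 := hz2.2
      rw [e1] at a1
      rw [e2, mul_pow, hprim.pow_eq_one, one_mul, ← a1] at a2
      exact (sub_left_injective a2).symm
    have := hinj hz1.1 hz2.1 this
    subst this
    rw [e1] at e2
    have : (ζ - 1) * t = 0 := by linear_combination -e2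
    rcases mul_eq_zero.1 this with h | h
    · exact hζ1 (sub_eq_zero.1 h)
    · exact ht h

/-- near-linear maps are locally surjective -/
theorem surj_of_approx {f : ℂ → ℂ} {d : ℂ} {q : ℝ} {s : Set ℂ} (hd : d ≠ 0) (hq0 : 0 ≤ q)
    (hf : ∀ x ∈ s, ∀ y ∈ s, ‖f x - f y - d * (x - y)‖ ≤ q * ‖d‖ * ‖x - y‖)
    {x : ℂ} {r : ℝ} (hr : 0 ≤ r) (hs : closedBall x r ⊆ s) {z : ℂ}
    (hz : ‖z - f x‖ ≤ (1 - q) * ‖d‖ * r) : ∃ y ∈ closedBall x r, f y = z := by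
  let e : ℂ ≃L[ℂ] ℂ := ContinuousLinearEquiv.unitsEquivAut ℂ (Units.mk0 d hd)
  let N : (e : ℂ →L[ℂ] ℂ).NonlinearRightInverse :=
    { toFun := fun y => y / d
      nnnorm := ‖d‖₊⁻¹
      bound' := fun y => by simp [div_eq_inv_mul]
      right_inv' := fun y => by
        change (y / d) * d = y
        exact div_mul_cancel₀ y hd }
  have hA : ApproximatesLinearOn f (e : ℂ →L[ℂ] ℂ) s (Real.toNNReal q * ‖d‖₊) := by
    intro x hx y hy
    have := hf x hx y hy
    have h2 : (e : ℂ →L[ℂ] ℂ) (x - y) = d * (x - y) := by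
      change (x - y) * d = _
      ring
    rw [h2]
    simpa [Real.coe_toNNReal q hq0] using this
  have := hA.surjOn_closedBall_of_nonlinearRightInverse N hr hs
  refine this ?_
  rw [mem_closedBall, dist_eq_norm]
  refine hz.trans (le_of_eq ?_)
  have : ((N.nnnorm : ℝ)⁻¹) = ‖d‖ := by simp [N]
  rw [this]
  simp only [NNReal.coe_mul, Real.coe_toNNReal q hq0, coe_nnnorm]
  ring

theorem hasDerivAt_of_comp {f g h : ℂ → ℂ} {f' g' x : ℂ} (hh : ContinuousAt h x)
    (hf : HasStrictDerivAt f f' (h x)) (hf' : f' ≠ 0) (hg : HasDerivAt g g' x)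
    (he : ∀ᶠ y in 𝓝 x, f (h y) = g y) : HasDerivAt h (f'⁻¹ * g') x := by
  have h1 := hf.eventually_left_inverse (hf' := hf')
  have h2 := hf.to_localInverse (hf' := hf')
  have hx : f (h x) = g x := he.self_of_nhds
  rw [hx] at h2
  have h3 := h2.hasDerivAt.comp x hg
  refine h3.congr_of_eventuallyEq ?_
  filter_upwards [hh.eventually h1, he] with y hy1 hy2
  simp only [Function.comp]
  rw [← hy2, hy1]

/-! ### Words -/

namespace HolIFS

variable (S : HolIFS)

theorem word_nil : S.word [] = id := rfl

theorem word_cons (i : Fin S.m) (w : List (Fin S.m)) : S.word (i :: w) = S.g i ∘ S.word w := rfl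

theorem word_append (u w : List (Fin S.m)) : S.word (u ++ w) = S.word u ∘ S.word w := by
  induction u with
  | nil => rfl
  | cons i u ih => rw [List.cons_append, word_cons, word_cons, ih]; rfl

theorem g_mem (i : Fin S.m) {x : ℂ} (hx : x ∈ S.Ω) : S.g i x ∈ S.Ω :=
  S.hcl i (subset_closure (mem_image_of_mem _ hx))

theorem word_mem (w : List (Fin S.m)) {x : ℂ} (hx : x ∈ S.Ω) : S.word w x ∈ S.Ω := by
  induction w with
  | nil => exact hx
  | cons i w ih => exact S.g_mem i ih

theorem g_diffAt (i : Fin S.m) {x : ℂ} (hx : x ∈ S.Ω) : DifferentiableAt ℂ (S.g i) x :=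
  (S.hdiff i).differentiableAt (S.hopen.mem_nhds hx)

theorem word_diff (w : List (Fin S.m)) : DifferentiableOn ℂ (S.word w) S.Ω := by
  induction w with
  | nil => exact differentiableOn_id
  | cons i w ih => exact (S.hdiff i).comp ih (fun x hx => S.word_mem w hx)

theorem word_diffAt (w : List (Fin S.m)) {x : ℂ} (hx : x ∈ S.Ω) :
    DifferentiableAt ℂ (S.word w) x :=
  (S.word_diff w).differentiableAt (S.hopen.mem_nhds hx)

theorem word_injOn (w : List (Fin S.m)) : Set.InjOn (S.word w) S.Ω := by
  induction w with
  | nil => exact injOn_id _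
  | cons i w ih => exact (S.hinj i).comp ih (fun x hx => S.word_mem w hx)

theorem word_deriv_ne (w : List (Fin S.m)) {x : ℂ} (hx : x ∈ S.Ω) : deriv (S.word w) x ≠ 0 :=
  injOn_deriv_ne_zero S.hopen (S.word_diff w) (S.word_injOn w) hx

theorem deriv_append (u w : List (Fin S.m)) {x : ℂ} (hx : x ∈ S.Ω) :
    deriv (S.word (u ++ w)) x = deriv (S.word u) (S.word w x) * deriv (S.word w) x := by
  rw [word_append]
  exact deriv_comp x (S.word_diffAt u (S.word_mem w hx)) (S.word_diffAt w hx)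

theorem deriv_cons (i : Fin S.m) (w : List (Fin S.m)) {x : ℂ} (hx : x ∈ S.Ω) :
    deriv (S.word (i :: w)) x = deriv (S.g i) (S.word w x) * deriv (S.word w) x := by
  rw [word_cons]
  exact deriv_comp x (S.g_diffAt i (S.word_mem w hx)) (S.word_diffAt w hx)

theorem exists_margin : ∃ δ > 0, ∀ i, ∀ x ∈ S.Ω, ball (S.g i x) δ ⊆ S.Ω := by
  have hK : IsCompact (⋃ i, closure (S.g i '' S.Ω)) := by
    apply isCompact_iUnion
    intro i
    exact (S.hbdd.subset (fun y hy => by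
      obtain ⟨x, hx, rfl⟩ := hy; exact S.g_mem i hx)).isCompact_closure
  obtain ⟨δ, hδ, h⟩ := hK.exists_thickening_subset_open S.hopen (iUnion_subset S.hcl)
  refine ⟨δ, hδ, fun i x hx => ?_⟩
  refine subset_trans ?_ h
  exact ball_subset_thickening (mem_iUnion.2 ⟨i, subset_closure (mem_image_of_mem _ hx)⟩) δ

theorem exists_bound : ∃ M > 0, ∀ x ∈ S.Ω, ‖x‖ ≤ M := by
  obtain ⟨M, hM, h⟩ := S.hbdd.exists_pos_norm_le
  exact ⟨M, hM, h⟩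

/-- Earle–Hamilton -/
theorem earle_hamilton : ∃ θ : ℝ, 0 < θ ∧ θ < 1 ∧ ∀ (z : ℂ) (r : ℝ), 0 < r →
    closedBall z r ⊆ S.Ω → ∀ (w : List (Fin S.m)) (h : ℂ → ℂ), DifferentiableOn ℂ h S.Ω →
    (∀ x ∈ S.Ω, ‖h x‖ ≤ 1) → ‖deriv (h ∘ S.word w) z‖ ≤ θ ^ w.length / r := by
  obtain ⟨δ, hδ, hmar⟩ := S.exists_margin
  obtain ⟨M, hM, hbd⟩ := S.exists_bound
  set ε := δ / (4 * M) with hε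
  have hε0 : 0 < ε := by positivity
  refine ⟨(1 + ε)⁻¹, by positivity, inv_lt_one_of_one_lt₀ (by linarith), ?_⟩
  intro z r hr hz w
  have hzΩ : z ∈ S.Ω := hz (mem_closedBall_self hr.le)
  induction w with
  | nil =>
    intro h hh hb
    have : ‖deriv h z‖ ≤ 1 / r := by
      apply Complex.norm_deriv_le_of_forall_mem_sphere_norm_le hr
      · exact (hh.mono (by rwa [closure_ball z hr.ne'])).diffContOnCl
      · exact fun x hx => hb x (hz (sphere_subset_closedBall hx))
    simpa [word_nil] using this
  | cons i w ih =>
    intro h hh hb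
    set z' := S.word w z with hz'
    have hz'Ω : z' ∈ S.Ω := S.word_mem w hzΩ
    set k : ℂ → ℂ := fun x => S.g i x + ε * (S.g i x - S.g i z') with hk
    have hkm : ∀ x ∈ S.Ω, k x ∈ S.Ω := by
      intro x hx
      apply hmar i x hx
      rw [mem_ball, dist_eq_norm, hk]
      simp only [add_sub_cancel_left, norm_mul, Complex.norm_real, Real.norm_eq_abs]
      rw [abs_of_pos hε0]
      have h1 : ‖S.g i x - S.g i z'‖ ≤ 2 * M := by
        have := norm_sub_le (S.g i x) (S.g i z')
        have := hbd _ (S.g_mem i hx)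
        have := hbd _ (S.g_mem i hz'Ω)
        linarith
      calc ε * ‖S.g i x - S.g i z'‖ ≤ ε * (2 * M) := by gcongr
        _ = δ / 2 := by rw [hε]; field_simp; norm_num
        _ < δ := by linarith
    have hkd : DifferentiableOn ℂ k S.Ω :=
      (S.hdiff i).add (((S.hdiff i).sub_const _).const_mul _)
    have hkk : k z' = S.g i z' := by simp [hk]
    have hkdz : deriv k z' = (1 + ε) * deriv (S.g i) z' := by
      have h1 := (S.g_diffAt i hz'Ω).hasDerivAt
      have h2 := h1.add ((h1.sub_const (S.g i z')).const_mul (ε : ℂ))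
      have h3 : deriv k z' = _ := h2.deriv
      rw [h3]; ring
    have hHd : DifferentiableOn ℂ (h ∘ k) S.Ω := hh.comp hkd hkm
    have h1 := ih (h ∘ k) hHd (fun x hx => hb _ (hkm x hx))
    have hopen := S.hopen
    have e1 : deriv ((h ∘ k) ∘ S.word w) z
        = deriv h (S.g i z') * ((1 + ε) * deriv (S.g i) z') * deriv (S.word w) z := by
      rw [deriv_comp z (hHd.differentiableAt (hopen.mem_nhds (S.word_mem w hzΩ)))
        (S.word_diffAt w hzΩ), ← hz']
      rw [deriv_comp _ (hh.differentiableAt (hopen.mem_nhds (hkm _ hz'Ω)))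
        (hkd.differentiableAt (hopen.mem_nhds hz'Ω))]
      rw [hkk, hkdz]
    have e2 : deriv (h ∘ S.word (i :: w)) z
        = deriv h (S.g i z') * deriv (S.g i) z' * deriv (S.word w) z := by
      rw [deriv_comp z (hh.differentiableAt (hopen.mem_nhds (S.word_mem _ hzΩ)))
        (S.word_diffAt _ hzΩ), S.deriv_cons i w hzΩ]
      simp only [word_cons, Function.comp]
      rw [← hz']; ring
    have e3 : deriv ((h ∘ k) ∘ S.word w) z = (1 + ε) * deriv (h ∘ S.word (i :: w)) z := by
      rw [e1, e2]; ring
    rw [e3, norm_mul] at h1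
    have h4 : ‖(1 + ε : ℂ)‖ = 1 + ε := by
      have : (1 + ε : ℂ) = ((1 + ε : ℝ) : ℂ) := by push_cast; rfl
      rw [this, Complex.norm_real, Real.norm_eq_abs, abs_of_pos (by linarith)]
    rw [h4] at h1
    rw [List.length_cons, pow_succ', mul_div_assoc]
    rw [inv_mul_eq_div, le_div_iff₀ (by linarith)]
    linarith

theorem deriv_decay : ∃ θ C : ℝ, 0 < θ ∧ θ < 1 ∧ 0 < C ∧ ∀ (z : ℂ) (r : ℝ), 0 < r →
    closedBall z r ⊆ S.Ω → ∀ (w : List (Fin S.m)),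
    ‖deriv (S.word w) z‖ ≤ C * θ ^ w.length / r := by
  obtain ⟨θ, h0, h1, H⟩ := S.earle_hamilton
  obtain ⟨M, hM, hbd⟩ := S.exists_bound
  refine ⟨θ, M, h0, h1, hM, fun z r hr hz w => ?_⟩
  have hzΩ : z ∈ S.Ω := hz (mem_closedBall_self hr.le)
  have := H z r hr hz w (fun x => (M : ℂ)⁻¹ * x) (by fun_prop) (by
    intro x hx
    rw [norm_mul, norm_inv, Complex.norm_real, Real.norm_eq_abs, abs_of_pos hM, inv_mul_le_iff₀ hM]
    simpa using hbd x hx)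
  have e : deriv ((fun x => (M : ℂ)⁻¹ * x) ∘ S.word w) z = (M : ℂ)⁻¹ * deriv (S.word w) z := by
    exact ((S.word_diffAt w hzΩ).hasDerivAt.const_mul (M : ℂ)⁻¹).deriv
  rw [e, norm_mul, norm_inv, Complex.norm_real, Real.norm_eq_abs, abs_of_pos hM,
    inv_mul_le_iff₀ hM] at this
  rwa [mul_div_assoc]

/-- two points get contracted together -/
theorem contract_local {z : ℂ} (hz : z ∈ S.Ω) : ∃ U ∈ 𝓝 z, U ⊆ S.Ω ∧ ∀ ε > (0 : ℝ), ∃ N : ℕ,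
    ∀ w : List (Fin S.m), N ≤ w.length → ∀ x ∈ U, ∀ y ∈ U, ‖S.word w x - S.word w y‖ < ε := by
  obtain ⟨θ, C, h0, h1, hC, H⟩ := S.deriv_decay
  obtain ⟨r, hr, hb⟩ := Metric.isOpen_iff.1 S.hopen z hz
  refine ⟨ball z (r / 3), ball_mem_nhds _ (by positivity),
    (ball_subset_ball (by linarith)).trans hb, fun ε hε => ?_⟩
  have hlim : Tendsto (fun n : ℕ => C * θ ^ n / (r / 3) * r) atTop (𝓝 0) := by
    have := (((tendsto_pow_atTop_nhds_zero_of_lt_one h0.le h1).const_mul C).div_const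
      (r / 3)).mul_const r
    simpa using this
  obtain ⟨N, hN⟩ := eventually_atTop.1 (hlim.eventually (gt_mem_nhds hε))
  refine ⟨N, fun w hw x hx y hy => ?_⟩
  refine lt_of_le_of_lt ?_ (hN _ hw)
  have hsub : ∀ u ∈ ball z (r / 3), closedBall u (r / 3) ⊆ S.Ω := by
    intro u hu v hv
    apply hb
    rw [mem_ball] at hu ⊢
    rw [mem_closedBall] at hv
    have := dist_triangle v u z
    linarith
  have h2 : ‖S.word w x - S.word w y‖ ≤ C * θ ^ w.length / (r / 3) * ‖x - y‖ := by
    apply (convex_ball z (r / 3)).norm_image_sub_le_of_norm_deriv_le (𝕜 := ℂ)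
      _ _ hy hx
    · intro u hu
      exact S.word_diffAt w (hsub u hu (mem_closedBall_self (by positivity)))
    · intro u hu
      exact H u _ (by positivity) (hsub u hu) w
  refine h2.trans ?_
  gcongr
  rw [← dist_eq_norm]
  rw [mem_ball] at hx hy
  have := dist_triangle_right x y z
  linarith

theorem contract_pt {x y : ℂ} (hx : x ∈ S.Ω) (hy : y ∈ S.Ω) : ∀ ε > (0 : ℝ), ∃ N : ℕ,
    ∀ w : List (Fin S.m), N ≤ w.length → ‖S.word w x - S.word w y‖ < ε := by
  refine S.hconn.isPreconnected.induction₂' (fun x y => ∀ ε > (0 : ℝ), ∃ N : ℕ,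
    ∀ w : List (Fin S.m), N ≤ w.length → ‖S.word w x - S.word w y‖ < ε) ?_ ?_ hx hy
  · intro z hz
    obtain ⟨U, hU, hUΩ, H⟩ := S.contract_local hz
    filter_upwards [mem_nhdsWithin_of_mem_nhds hU] with y hy
    constructor
    · intro ε hε
      obtain ⟨N, hN⟩ := H ε hε
      exact ⟨N, fun w hw => hN w hw _ (mem_of_mem_nhds hU) _ hy⟩
    · intro ε hε
      obtain ⟨N, hN⟩ := H ε hε
      exact ⟨N, fun w hw => hN w hw _ hy _ (mem_of_mem_nhds hU)⟩
  · intro x y z _ _ _ h1 h2 ε hε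
    obtain ⟨N, hN⟩ := h1 (ε / 2) (by positivity)
    obtain ⟨N', hN'⟩ := h2 (ε / 2) (by positivity)
    refine ⟨max N N', fun w hw => ?_⟩
    have a := hN w (le_of_max_le_left hw)
    have b := hN' w (le_of_max_le_right hw)
    have := norm_sub_le_norm_sub_add_norm_sub (S.word w x) (S.word w y) (S.word w z)
    linarith

theorem contract_compact {K : Set ℂ} (hK : IsCompact K) (hKΩ : K ⊆ S.Ω) {x₀ : ℂ} (hx₀ : x₀ ∈ S.Ω) :
    ∀ ε > (0 : ℝ), ∃ N : ℕ,
    ∀ w : List (Fin S.m), N ≤ w.length → ∀ x ∈ K, ‖S.word w x - S.word w x₀‖ < ε := by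
  intro ε hε
  refine hK.induction_on (p := fun K => ∃ N : ℕ,
    ∀ w : List (Fin S.m), N ≤ w.length → ∀ x ∈ K, ‖S.word w x - S.word w x₀‖ < ε) ?_ ?_ ?_ ?_
  · exact ⟨0, by simp⟩
  · rintro s t hst ⟨N, hN⟩
    exact ⟨N, fun w hw x hx => hN w hw x (hst hx)⟩
  · rintro s t ⟨N, hN⟩ ⟨N', hN'⟩
    refine ⟨max N N', fun w hw x hx => ?_⟩
    rcases hx with hx | hx
    · exact hN w (le_of_max_le_left hw) x hx
    · exact hN' w (le_of_max_le_right hw) x hx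
  · intro z hz
    obtain ⟨U, hU, hUΩ, H⟩ := S.contract_local (hKΩ hz)
    refine ⟨U, mem_nhdsWithin_of_mem_nhds hU, ?_⟩
    obtain ⟨N, hN⟩ := H (ε / 2) (by positivity)
    obtain ⟨N', hN'⟩ := S.contract_pt (hKΩ hz) hx₀ (ε / 2) (by positivity)
    refine ⟨max N N', fun w hw x hx => ?_⟩
    have a := hN w (le_of_max_le_left hw) x hx z (mem_of_mem_nhds hU)
    have b := hN' w (le_of_max_le_right hw)
    have := norm_sub_le_norm_sub_add_norm_sub (S.word w x) (S.word w z) (S.word w x₀)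
    linarith

/-! ### Attractor -/

theorem fin_small {n : ℕ} {P : Fin n → ℝ → Prop}
    (h : ∀ i, ∃ c > 0, ∀ c', 0 < c' → c' ≤ c → P i c') : ∃ c > 0, ∀ i, P i c := by
  have h1 : ∀ᶠ c in 𝓝[>] (0 : ℝ), ∀ i, P i c := by
    rw [eventually_all]
    intro i
    obtain ⟨c, hc, H⟩ := h i
    filter_upwards [Ioc_mem_nhdsGT hc] with c' hc' using H c' hc'.1 hc'.2
  obtain ⟨c, hc, h2⟩ := ((eventually_mem_nhdsWithin (a := (0 : ℝ)) (s := Ioi 0)).and h1).exists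
  exact ⟨c, hc, h2⟩

variable {S} {A : Set ℂ}

theorem IsAttractor.g_mem (hA : S.IsAttractor A) (i : Fin S.m) {x : ℂ} (hx : x ∈ A) :
    S.g i x ∈ A := by
  rw [hA.2.2.2]
  exact mem_iUnion.2 ⟨i, mem_image_of_mem _ hx⟩

theorem IsAttractor.word_mem (hA : S.IsAttractor A) (w : List (Fin S.m)) {x : ℂ} (hx : x ∈ A) :
    S.word w x ∈ A := by
  induction w with
  | nil => exact hx
  | cons i w ih => exact hA.g_mem i ih

theorem IsAttractor.exists_pre (hA : S.IsAttractor A) {x : ℂ} (hx : x ∈ A) :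
    ∃ i, ∃ y ∈ A, S.g i y = x := by
  rw [hA.2.2.2] at hx
  obtain ⟨i, y, hy, h⟩ := mem_iUnion.1 hx
  exact ⟨i, y, hy, h⟩

theorem IsAttractor.exists_word (hA : S.IsAttractor A) (n : ℕ) {x : ℂ} (hx : x ∈ A) :
    ∃ w : List (Fin S.m), w.length = n ∧ ∃ y ∈ A, S.word w y = x := by
  induction n generalizing x with
  | zero => exact ⟨[], rfl, x, hx, rfl⟩
  | succ n ih =>
    obtain ⟨i, y, hy, rfl⟩ := hA.exists_pre hx
    obtain ⟨w, hw, z, hz, rfl⟩ := ih hy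
    exact ⟨i :: w, by simp [hw], z, hz, rfl⟩

theorem IsAttractor.exists_ball (hA : S.IsAttractor A) : ∃ ρ > 0, ∀ a ∈ A, ball a ρ ⊆ S.Ω := by
  obtain ⟨δ, hδ, h⟩ := hA.2.1.exists_thickening_subset_open S.hopen hA.2.2.1
  exact ⟨δ, hδ, fun a ha => (ball_subset_thickening ha δ).trans h⟩

theorem IsAttractor.lip (hA : S.IsAttractor A) : ∃ ρ > 0, ∃ θ C : ℝ, 0 < θ ∧ θ < 1 ∧ 0 < C ∧
    ∀ a ∈ A, ball a ρ ⊆ S.Ω ∧ ∀ w : List (Fin S.m),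
      (∀ x ∈ ball a ρ, ‖deriv (S.word w) x‖ ≤ C * θ ^ w.length) ∧
      ∀ x ∈ ball a ρ, ∀ y ∈ ball a ρ,
        ‖S.word w x - S.word w y‖ ≤ C * θ ^ w.length * ‖x - y‖ := by
  obtain ⟨r, hr, hb⟩ := hA.exists_ball
  obtain ⟨θ, C, h0, h1, hC, H⟩ := S.deriv_decay
  refine ⟨r / 3, by positivity, θ, C / (r / 3), h0, h1, by positivity, fun a ha => ?_⟩
  have hsub : ∀ u ∈ ball a (r / 3), closedBall u (r / 3) ⊆ S.Ω := by
    intro u hu v hv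
    apply hb a ha
    rw [mem_ball] at hu ⊢
    rw [mem_closedBall] at hv
    have := dist_triangle v u a
    linarith
  have hsub2 : ball a (r / 3) ⊆ S.Ω := fun u hu => hsub u hu (mem_closedBall_self (by positivity))
  refine ⟨hsub2, fun w => ?_⟩
  have hd : ∀ x ∈ ball a (r / 3), ‖deriv (S.word w) x‖ ≤ C / (r / 3) * θ ^ w.length := by
    intro x hx
    have := H x _ (by positivity) (hsub x hx) w
    rwa [div_mul_eq_mul_div]
  refine ⟨hd, fun x hx y hy => ?_⟩
  exact (convex_ball a (r / 3)).norm_image_sub_le_of_norm_deriv_le (𝕜 := ℂ)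
    (fun u hu => S.word_diffAt w (hsub2 hu)) hd hy hx

theorem IsAttractor.decay (hA : S.IsAttractor A) : ∀ ε > (0 : ℝ), ∃ N : ℕ,
    ∀ w : List (Fin S.m), N ≤ w.length → ∀ a ∈ A, ‖deriv (S.word w) a‖ < ε := by
  intro ε hε
  obtain ⟨ρ, hρ, θ, C, h0, h1, hC, H⟩ := hA.lip
  have hlim : Tendsto (fun n : ℕ => C * θ ^ n) atTop (𝓝 0) := by
    simpa using (tendsto_pow_atTop_nhds_zero_of_lt_one h0.le h1).const_mul C
  obtain ⟨N, hN⟩ := eventually_atTop.1 (hlim.eventually (gt_mem_nhds hε))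
  exact ⟨N, fun w hw a ha => (((H a ha).2 w).1 a (mem_ball_self hρ)).trans_lt (hN _ hw)⟩

theorem g_deriv_ne (i : Fin S.m) {x : ℂ} (hx : x ∈ S.Ω) : deriv (S.g i) x ≠ 0 :=
  injOn_deriv_ne_zero S.hopen (S.hdiff i) (S.hinj i) hx

theorem IsAttractor.lower (hA : S.IsAttractor A) : ∃ c > 0, ∀ i, ∀ a ∈ A,
    c ≤ ‖deriv (S.g i) a‖ := by
  apply fin_small
  intro i
  have hc : ContinuousOn (fun a => ‖deriv (S.g i) a‖) A :=
    (((S.hdiff i).deriv S.hopen).continuousOn.mono hA.2.2.1).norm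
  obtain ⟨c, hc0, H⟩ := hA.2.1.exists_forall_le' hc (a := 0)
    (fun a ha => norm_pos_iff.2 (g_deriv_ne i (hA.2.2.1 ha)))
  exact ⟨c, hc0, fun c' _ h a ha => h.trans (H a ha)⟩

theorem IsAttractor.cutWord (hA : S.IsAttractor A) : ∃ m > 0, m ≤ 1 ∧ ∀ c ∈ A, ∀ τ : ℝ, 0 < τ →
    τ ≤ 1 → ∃ u : List (Fin S.m), ∃ c' ∈ A, S.word u c' = c ∧ m * τ ≤ ‖deriv (S.word u) c'‖ ∧
      ‖deriv (S.word u) c'‖ < τ := by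
  obtain ⟨m, hm, H⟩ := hA.lower
  refine ⟨min m 1, by positivity, min_le_right _ _, fun c hc τ hτ hτ1 => ?_⟩
  by_contra hcon
  have key : ∀ n : ℕ, ∃ u : List (Fin S.m), u.length = n ∧ ∃ c' ∈ A, S.word u c' = c ∧
      τ ≤ ‖deriv (S.word u) c'‖ := by
    intro n
    induction n with
    | zero => exact ⟨[], rfl, c, hc, rfl, by simpa [word_nil] using hτ1⟩
    | succ n ih =>
      obtain ⟨u, hu, c', hc', rfl, h1⟩ := ih
      obtain ⟨i, y, hy, rfl⟩ := hA.exists_pre hc'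
      refine ⟨u ++ [i], by simp [hu], y, hy, by rw [word_append]; rfl, ?_⟩
      by_contra hlt
      apply hcon
      refine ⟨u ++ [i], y, hy, by rw [word_append]; rfl, ?_, not_le.1 hlt⟩
      rw [S.deriv_append u [i] (hA.2.2.1 hy), norm_mul]
      change min m 1 * τ ≤ ‖deriv (S.word u) (S.g i y)‖ * ‖deriv (S.g i) y‖
      calc min m 1 * τ ≤ m * τ := by gcongr; exact min_le_left _ _
        _ ≤ ‖deriv (S.g i) y‖ * ‖deriv (S.word u) (S.g i y)‖ := by
          gcongr
          exact H i y hy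
        _ = _ := mul_comm _ _
  obtain ⟨N, hN⟩ := hA.decay τ hτ
  obtain ⟨u, hu, c', hc', _, h1⟩ := key N
  exact absurd (hN u hu.ge c' hc') (not_lt.2 h1)

theorem IsAttractor.one_dist (hA : S.IsAttractor A) : ∃ ρ > 0, ∃ L > 0, ∀ i, ∀ a ∈ A,
    ∀ x ∈ ball a ρ, ‖deriv (S.g i) x - deriv (S.g i) a‖ ≤ L * ‖x - a‖ * ‖deriv (S.g i) a‖ := by
  obtain ⟨ρ, hρ, hsub⟩ := hA.2.1.exists_cthickening_subset_open S.hopen hA.2.2.1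
  obtain ⟨c, hc, hlow⟩ := hA.lower
  have hK : IsCompact (cthickening ρ A) := hA.2.1.cthickening
  have hB : ∀ i, ∃ B : ℝ, ∀ x ∈ cthickening ρ A, ‖deriv (deriv (S.g i)) x‖ ≤ B := by
    intro i
    exact hK.exists_bound_of_continuousOn
      ((((S.hdiff i).deriv S.hopen).deriv S.hopen).continuousOn.mono hsub)
  choose B hB using hB
  refine ⟨ρ, hρ, ((∑ i, |B i|) + 1) / c, by positivity, fun i a ha x hx => ?_⟩
  have hball : ball a ρ ⊆ cthickening ρ A :=
    (ball_subset_thickening ha ρ).trans (thickening_subset_cthickening ρ A)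
  have h1 : ‖deriv (S.g i) x - deriv (S.g i) a‖ ≤ B i * ‖x - a‖ :=
    (convex_ball a ρ).norm_image_sub_le_of_norm_deriv_le (𝕜 := ℂ)
      (fun u hu => ((S.hdiff i).deriv S.hopen).differentiableAt
        (S.hopen.mem_nhds (hsub (hball hu)))) (fun u hu => hB i u (hball hu))
      (mem_ball_self hρ) hx
  have h2 : B i ≤ (∑ i, |B i|) + 1 := by
    have := Finset.single_le_sum (f := fun i => |B i|) (fun i _ => abs_nonneg _)
      (Finset.mem_univ i)
    have h3 := le_abs_self (B i)
    linarith
  calc _ ≤ B i * ‖x - a‖ := h1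
    _ ≤ ((∑ i, |B i|) + 1) * ‖x - a‖ := by gcongr
    _ = ((∑ i, |B i|) + 1) / c * ‖x - a‖ * c := by field_simp
    _ ≤ _ := by gcongr; exact hlow i a ha

theorem IsAttractor.word_dist (hA : S.IsAttractor A) : ∃ ρ > 0, ∀ a ∈ A, ball a ρ ⊆ S.Ω ∧
    ∀ w : List (Fin S.m), ∀ x ∈ ball a ρ,
      ‖deriv (S.word w) x - deriv (S.word w) a‖ ≤ 1 / 4 * ‖deriv (S.word w) a‖ := by
  obtain ⟨ρ₁, hρ₁, L, hL, H1⟩ := hA.one_dist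
  obtain ⟨ρ₂, hρ₂, θ, C, h0, h1, hC, H2⟩ := hA.lip
  have h1θ : 0 < 1 - θ := by linarith
  set ρ := min (min ρ₂ (ρ₁ / C)) ((1 - θ) / (8 * L * C)) with hρdef
  have hρ : 0 < ρ := by positivity
  have e1 : ρ ≤ ρ₂ := (min_le_left _ _).trans (min_le_left _ _)
  have e2 : C * ρ ≤ ρ₁ := by
    have : ρ ≤ ρ₁ / C := (min_le_left _ _).trans (min_le_right _ _)
    rw [le_div_iff₀ hC] at this
    linarith
  set q := L * C * ρ with hq
  have hq0 : 0 < q := by positivity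
  have e3 : q ≤ (1 - θ) / 8 := by
    have : ρ ≤ (1 - θ) / (8 * L * C) := min_le_right _ _
    rw [le_div_iff₀ (by positivity)] at this
    rw [hq]; linarith
  refine ⟨ρ, hρ, fun a ha => ⟨(ball_subset_ball e1).trans (H2 a ha).1, fun w x hx => ?_⟩⟩
  have hxΩ : x ∈ S.Ω := (H2 a ha).1 (ball_subset_ball e1 hx)
  have key : ‖deriv (S.word w) x - deriv (S.word w) a‖ ≤
      (Real.exp (q * ∑ j ∈ Finset.range w.length, θ ^ j) - 1) * ‖deriv (S.word w) a‖ := by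
    induction w with
    | nil => simp [word_nil]
    | cons i w ih =>
      rw [S.deriv_cons i w hxΩ, S.deriv_cons i w (hA.2.2.1 ha), List.length_cons,
        Finset.sum_range_succ, mul_add, Real.exp_add, norm_mul]
      set α' := deriv (S.g i) (S.word w x)
      set α := deriv (S.g i) (S.word w a)
      set R := deriv (S.word w) x
      set D := deriv (S.word w) a
      set E := Real.exp (q * ∑ j ∈ Finset.range w.length, θ ^ j)
      have hlip := ((H2 a ha).2 w).2 x (ball_subset_ball e1 hx) a (mem_ball_self hρ₂)
      have hxa : ‖x - a‖ < ρ := by rwa [← dist_eq_norm]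
      have hθn : θ ^ w.length ≤ 1 := pow_le_one₀ h0.le h1.le
      have hdd : ‖S.word w x - S.word w a‖ ≤ C * θ ^ w.length * ρ := by
        refine hlip.trans ?_
        gcongr
      have hmem : S.word w x ∈ ball (S.word w a) ρ₁ := by
        rw [mem_ball, dist_eq_norm]
        calc ‖S.word w x - S.word w a‖ ≤ C * θ ^ w.length * ‖x - a‖ := hlip
          _ ≤ C * 1 * ‖x - a‖ := by gcongr
          _ < C * 1 * ρ := by gcongr
          _ ≤ ρ₁ := by linarith
      have hα : ‖α' - α‖ ≤ q * θ ^ w.length * ‖α‖ := by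
        refine (H1 i _ (hA.word_mem w ha) _ hmem).trans ?_
        refine mul_le_mul_of_nonneg_right ?_ (norm_nonneg _)
        calc L * ‖S.word w x - S.word w a‖ ≤ L * (C * θ ^ w.length * ρ) := by gcongr
          _ = q * θ ^ w.length := by rw [hq]; ring
      have hR : ‖R‖ ≤ E * ‖D‖ := by
        have := norm_sub_norm_le R D
        linarith
      have hexp : q * θ ^ w.length + 1 ≤ Real.exp (q * θ ^ w.length) := Real.add_one_le_exp _
      have hE : 0 ≤ E := (Real.exp_pos _).le
      calc ‖α' * R - α * D‖ = ‖(α' - α) * R + α * (R - D)‖ := by ring_nf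
        _ ≤ ‖α' - α‖ * ‖R‖ + ‖α‖ * ‖R - D‖ := by
          refine (norm_add_le _ _).trans ?_
          rw [norm_mul, norm_mul]
        _ ≤ (q * θ ^ w.length * ‖α‖) * (E * ‖D‖) + ‖α‖ * ((E - 1) * ‖D‖) := by gcongr
        _ = (E * (q * θ ^ w.length + 1) - 1) * (‖α‖ * ‖D‖) := by ring
        _ ≤ (E * Real.exp (q * θ ^ w.length) - 1) * (‖α‖ * ‖D‖) := by gcongr
  refine key.trans ?_
  gcongr
  have hs : ∑ j ∈ Finset.range w.length, θ ^ j ≤ 1 / (1 - θ) := by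
    rw [geom_sum_eq h1.ne, ← neg_div_neg_eq]
    rw [neg_sub, neg_sub]
    gcongr
    have : 0 ≤ θ ^ w.length := by positivity
    linarith
  have hs0 : 0 ≤ ∑ j ∈ Finset.range w.length, θ ^ j := by positivity
  have h5 : q * ∑ j ∈ Finset.range w.length, θ ^ j ≤ 1 / 8 := by
    calc _ ≤ (1 - θ) / 8 * (1 / (1 - θ)) := by gcongr
      _ = 1 / 8 := by field_simp
  have h6 : 0 ≤ q * ∑ j ∈ Finset.range w.length, θ ^ j := by positivity
  have h7 := Real.abs_exp_sub_one_le (x := q * ∑ j ∈ Finset.range w.length, θ ^ j)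
    (by rw [abs_of_nonneg h6]; linarith)
  rw [abs_of_nonneg h6] at h7
  have := le_abs_self (Real.exp (q * ∑ j ∈ Finset.range w.length, θ ^ j) - 1)
  linarith

theorem IsAttractor.compl_closed (hA : S.IsAttractor A) (i : Fin S.m) :
    IsCompact (⋃ j : {j // j ≠ i}, S.g j '' A) := by
  apply isCompact_iUnion
  intro j
  exact hA.2.1.image_of_continuousOn ((S.hdiff _).continuousOn.mono hA.2.2.1)

theorem IsAttractor.one_sep (hA : S.IsAttractor A) (hS : S.SSC A) : ∃ ρ > 0, ∀ i, ∀ a ∈ A,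
    ∀ x ∈ ball a ρ, S.g i x ∈ A → x ∈ A := by
  apply fin_small
  intro i
  set K := ⋃ j : {j // j ≠ i}, S.g j '' A with hK
  have hop : IsOpen (S.Ω ∩ S.g i ⁻¹' Kᶜ) :=
    (S.hdiff i).continuousOn.isOpen_inter_preimage S.hopen (hA.compl_closed i).isClosed.isOpen_compl
  have hsub : A ⊆ S.Ω ∩ S.g i ⁻¹' Kᶜ := by
    intro a ha
    refine ⟨hA.2.2.1 ha, fun hk => ?_⟩
    obtain ⟨⟨j, hj⟩, hk⟩ := mem_iUnion.1 hk
    exact disjoint_left.1 (hS j i hj) hk (mem_image_of_mem _ ha)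
  obtain ⟨ρ, hρ, h⟩ := hA.2.1.exists_thickening_subset_open hop hsub
  refine ⟨ρ, hρ, fun ρ' _ hρ' a ha x hx hgx => ?_⟩
  have hx2 := h (ball_subset_thickening ha ρ (ball_subset_ball hρ' hx))
  obtain ⟨j, y, hy, hgy⟩ := hA.exists_pre hgx
  by_cases hj : j = i
  · subst hj
    have := S.hinj j (hA.2.2.1 hy) hx2.1 hgy
    rwa [← this]
  · exact (hx2.2 (mem_iUnion.2 ⟨⟨j, hj⟩, y, hy, hgy⟩)).elim

/-- uniform geometry at scale `ρ` around the attractor -/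
structure Geo (S : HolIFS) (A : Set ℂ) (ρ : ℝ) : Prop where
  pos : 0 < ρ
  sub : ∀ a ∈ A, ball a ρ ⊆ S.Ω
  lin : ∀ (w : List (Fin S.m)), ∀ a ∈ A, ∀ x ∈ ball a ρ, ∀ y ∈ ball a ρ,
    ‖S.word w x - S.word w y - deriv (S.word w) a * (x - y)‖ ≤
      1 / 4 * ‖deriv (S.word w) a‖ * ‖x - y‖
  sep : ∀ (w : List (Fin S.m)), ∀ a ∈ A, ∀ x ∈ ball a ρ, S.word w x ∈ A → x ∈ A

theorem IsAttractor.exists_geo (hA : S.IsAttractor A) (hS : S.SSC A) :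
    ∃ ρ₀ > 0, ∀ ρ, 0 < ρ → ρ ≤ ρ₀ → Geo S A ρ := by
  obtain ⟨ρ₁, hρ₁, H1⟩ := hA.word_dist
  obtain ⟨ρ₂, hρ₂, H2⟩ := hA.one_sep hS
  obtain ⟨ρ₃, hρ₃, θ, C, h0, h1, hC, H3⟩ := hA.lip
  refine ⟨min (min ρ₁ ρ₃) (ρ₂ / C), by positivity, fun ρ hρ hle => ?_⟩
  have e1 : ρ ≤ ρ₁ := hle.trans ((min_le_left _ _).trans (min_le_left _ _))
  have e3 : ρ ≤ ρ₃ := hle.trans ((min_le_left _ _).trans (min_le_right _ _))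
  have e2 : C * ρ ≤ ρ₂ := by
    have : ρ ≤ ρ₂ / C := hle.trans (min_le_right _ _)
    rw [le_div_iff₀ hC] at this
    linarith
  refine ⟨hρ, fun a ha => (ball_subset_ball e1).trans (H1 a ha).1, ?_, ?_⟩
  · intro w a ha x hx y hy
    have hsub := (ball_subset_ball e1).trans (H1 a ha).1
    have := (convex_ball a ρ).norm_image_sub_le_of_norm_deriv_le (𝕜 := ℂ)
      (f := fun z => S.word w z - deriv (S.word w) a * z)
      (C := 1 / 4 * ‖deriv (S.word w) a‖)
      (fun u hu => (S.word_diffAt w (hsub hu)).sub (by fun_prop)) (fun u hu => by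
        have h5 : HasDerivAt (fun z => S.word w z - deriv (S.word w) a * z)
            (deriv (S.word w) u - deriv (S.word w) a * 1) u :=
          (S.word_diffAt w (hsub hu)).hasDerivAt.sub ((hasDerivAt_id u).const_mul _)
        rw [h5.deriv, mul_one]
        exact (H1 a ha).2 w u (ball_subset_ball e1 hu)) hy hx
    refine le_trans (le_of_eq ?_) this
    congr 1
    ring
  · intro w a ha x hx
    induction w with
    | nil => exact fun h => h
    | cons i w ih =>
      intro h
      apply ih
      refine H2 i (S.word w a) (hA.word_mem w ha) _ ?_ h
      have hlip := ((H3 a ha).2 w).2 x (ball_subset_ball e3 hx) a (mem_ball_self hρ₃)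
      have hxa : ‖x - a‖ < ρ := by rwa [← dist_eq_norm]
      have hθn : θ ^ w.length ≤ 1 := pow_le_one₀ h0.le h1.le
      rw [mem_ball, dist_eq_norm]
      calc ‖S.word w x - S.word w a‖ ≤ C * θ ^ w.length * ‖x - a‖ := hlip
        _ ≤ C * 1 * ‖x - a‖ := by gcongr
        _ < C * 1 * ρ := by gcongr
        _ ≤ ρ₂ := by linarith

theorem IsAttractor.one_gap (hA : S.IsAttractor A) (hS : S.SSC A) : ∃ δ > 0, ∀ i,
    ∀ x ∈ S.g i '' A, ∀ y ∈ A, ‖x - y‖ < δ → y ∈ S.g i '' A := by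
  apply fin_small
  intro i
  set K := ⋃ j : {j // j ≠ i}, S.g j '' A with hK
  have hc : IsCompact (S.g i '' A) :=
    hA.2.1.image_of_continuousOn ((S.hdiff _).continuousOn.mono hA.2.2.1)
  have hsub : S.g i '' A ⊆ Kᶜ := by
    intro a ha hk
    obtain ⟨⟨j, hj⟩, hk⟩ := mem_iUnion.1 hk
    exact disjoint_left.1 (hS j i hj) hk ha
  obtain ⟨ρ, hρ, h⟩ := hc.exists_thickening_subset_open
    (hA.compl_closed i).isClosed.isOpen_compl hsub
  refine ⟨ρ, hρ, fun ρ' _ hρ' x hx y hy hxy => ?_⟩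
  have hy2 : y ∈ Kᶜ := h (ball_subset_thickening hx ρ (by
    rw [mem_ball, dist_comm, dist_eq_norm]; linarith))
  obtain ⟨j, z, hz, rfl⟩ := hA.exists_pre hy
  by_cases hj : j = i
  · subst hj
    exact mem_image_of_mem _ hz
  · exact (hy2 (mem_iUnion.2 ⟨⟨j, hj⟩, z, hz, rfl⟩)).elim

theorem IsAttractor.inv_unif (hA : S.IsAttractor A) {ε : ℝ} (hε : 0 < ε) : ∃ δ > 0, ∀ i,
    ∀ x ∈ A, ∀ y ∈ A, ‖S.g i x - S.g i y‖ < δ → ‖x - y‖ < ε := by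
  apply fin_small
  intro i
  have hK : IsCompact ((A ×ˢ A) ∩ {p : ℂ × ℂ | ε ≤ ‖p.1 - p.2‖}) :=
    (hA.2.1.prod hA.2.1).inter_right (isClosed_le continuous_const (by fun_prop))
  have hc := (S.hdiff i).continuousOn.mono hA.2.2.1
  obtain ⟨c, hc0, H⟩ := hK.exists_forall_le' (f := fun p : ℂ × ℂ => ‖S.g i p.1 - S.g i p.2‖)
    (a := 0) (by
      refine ContinuousOn.norm (ContinuousOn.sub ?_ ?_)
      · exact hc.comp continuousOn_fst (fun p hp => hp.1.1)
      · exact hc.comp continuousOn_snd (fun p hp => hp.1.2)) (by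
      rintro ⟨x, y⟩ ⟨⟨hx, hy⟩, hxy⟩
      replace hxy : ε ≤ ‖x - y‖ := hxy
      replace hx : x ∈ A := hx
      replace hy : y ∈ A := hy
      refine norm_pos_iff.2 (sub_ne_zero.2 fun h => ?_)
      have := S.hinj i (hA.2.2.1 hx) (hA.2.2.1 hy) h
      subst this
      simp at hxy
      linarith)
  refine ⟨c, hc0, fun c' _ hc' x hx y hy hxy => ?_⟩
  by_contra hcon
  have := H (x, y) ⟨⟨hx, hy⟩, not_lt.1 hcon⟩
  simp only at this
  linarith

theorem IsAttractor.disc (hA : S.IsAttractor A) (hS : S.SSC A) (N : ℕ) : ∃ δ > 0, ∀ p ∈ A,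
    ∃ w : List (Fin S.m), w.length = N ∧ p ∈ S.word w '' A ∧
      ∀ x ∈ S.word w '' A, ∀ y ∈ A, ‖x - y‖ < δ → y ∈ S.word w '' A := by
  induction N with
  | zero =>
    refine ⟨1, one_pos, fun p hp => ⟨[], rfl, ⟨p, hp, rfl⟩, fun x _ y hy _ => ⟨y, hy, rfl⟩⟩⟩
  | succ N ih =>
    obtain ⟨δ, hδ, H⟩ := ih
    obtain ⟨δ₁, hδ₁, H1⟩ := hA.one_gap hS
    obtain ⟨δ₂, hδ₂, H2⟩ := hA.inv_unif hδ
    refine ⟨min δ₁ δ₂, by positivity, fun p hp => ?_⟩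
    obtain ⟨i, p', hp', rfl⟩ := hA.exists_pre hp
    obtain ⟨w, hw, ⟨p'', hp'', rfl⟩, hc⟩ := H p' hp'
    refine ⟨i :: w, by simp [hw], ⟨p'', hp'', rfl⟩, ?_⟩
    rintro x ⟨x', hx', rfl⟩ y hy hxy
    obtain ⟨y', hy', rfl⟩ := H1 i _ (mem_image_of_mem _ (hA.word_mem w hx')) y hy
      (hxy.trans_le (min_le_left _ _))
    have := H2 i _ (hA.word_mem w hx') y' hy' (hxy.trans_le (min_le_right _ _))
    obtain ⟨y'', hy'', rfl⟩ := hc _ (mem_image_of_mem _ hx') y' hy' this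
    exact ⟨y'', hy'', rfl⟩

theorem IsAttractor.small (hA : S.IsAttractor A) {ε : ℝ} (hε : 0 < ε) : ∃ N : ℕ,
    ∀ w : List (Fin S.m), N ≤ w.length → ∀ x ∈ A, ∀ y ∈ A, ‖S.word w x - S.word w y‖ < ε := by
  obtain ⟨a, ha⟩ := hA.1
  obtain ⟨N, hN⟩ := S.contract_compact hA.2.1 hA.2.2.1 (hA.2.2.1 ha) (ε / 2) (by positivity)
  refine ⟨N, fun w hw x hx y hy => ?_⟩
  have h1 := hN w hw x hx
  have h2 := hN w hw y hy
  have := norm_sub_le_norm_sub_add_norm_sub (S.word w x) (S.word w a) (S.word w y)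
  rw [norm_sub_rev (S.word w a)] at this
  linarith

theorem IsAttractor.isolate (hA : S.IsAttractor A) (hS : S.SSC A) {R : ℝ} (hR : 0 < R) :
    ∃ δ > 0, ∀ p ∈ A, ∃ K ⊆ A, p ∈ K ∧ (∀ x ∈ K, ‖x - p‖ < R) ∧
      ∀ x ∈ K, ∀ y ∈ A, ‖x - y‖ < δ → y ∈ K := by
  obtain ⟨N, hN⟩ := hA.small hR
  obtain ⟨δ, hδ, H⟩ := hA.disc hS N
  refine ⟨δ, hδ, fun p hp => ?_⟩
  obtain ⟨w, hw, ⟨p', hp', rfl⟩, hc⟩ := H p hp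
  refine ⟨S.word w '' A, ?_, ⟨p', hp', rfl⟩, ?_, hc⟩
  · rintro _ ⟨x, hx, rfl⟩
    exact hA.word_mem w hx
  · rintro _ ⟨x, hx, rfl⟩
    exact hN w hw.ge x hx p' hp'

theorem IsAttractor.perfect (hA : S.IsAttractor A) (hnt : A.Nontrivial) {a : ℂ} (ha : a ∈ A)
    {ε : ℝ} (hε : 0 < ε) : ∃ b ∈ A, b ≠ a ∧ ‖b - a‖ < ε := by
  obtain ⟨N, hN⟩ := hA.small hε
  obtain ⟨w, hw, y, hy, rfl⟩ := hA.exists_word N ha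
  obtain ⟨z, hz, hzy⟩ := hnt.exists_ne y
  refine ⟨S.word w z, hA.word_mem w hz, fun h => hzy ?_, hN w hw.ge z hz y hy⟩
  exact S.word_injOn w (hA.2.2.1 hz) (hA.2.2.1 hy) h

theorem IsAttractor.rigid (hA : S.IsAttractor A) (hS : S.SSC A) {s : ℝ} (hs : 0 < s) :
    ∃ ε > 0, ∀ a ∈ A, ∀ T : ℂ → ℂ, (∀ x ∈ A, x ∈ ball a s → T x ∈ A) →
      (∀ x ∈ A, x ∈ ball a s → ‖T x - x‖ ≤ ε) →
      (∀ x ∈ A, x ∈ ball a s → ∀ y ∈ A, y ∈ ball a s →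
        ‖(T x - x) - (T y - y)‖ ≤ ε * ‖x - y‖) →
      ∀ c ∈ A, c ∈ ball a (s / 2) → T c = c := by
  obtain ⟨ρ, hρ, hgeo⟩ := hA.exists_geo hS
  have hG := hgeo ρ hρ le_rfl
  obtain ⟨δ, hδ, hiso⟩ := hA.isolate hS (half_pos hρ)
  obtain ⟨m, hm, hm1, hcut⟩ := hA.cutWord
  set r := min (δ / 2) (ρ / 4) with hr
  have hr0 : 0 < r := by positivity
  have hrδ : r < δ := (min_le_left _ _).trans_lt (by linarith)
  have hrρ : r ≤ ρ / 4 := min_le_right _ _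
  set κ := m * r / 2 with hκ
  have hκ0 : 0 < κ := by positivity
  set ε := min κ (min (κ / (2 * ρ)) (κ * s / (2 * ρ))) with hε
  refine ⟨ε, by positivity, fun a ha T hTA hTd hTl c hc hca => ?_⟩
  have hε1 : ε ≤ κ := min_le_left _ _
  have hε2 : ε * ρ ≤ κ / 2 := by
    have : ε ≤ κ / (2 * ρ) := (min_le_right _ _).trans (min_le_left _ _)
    rw [le_div_iff₀ (by positivity)] at this
    linarith
  have hε3 : ε * ρ ≤ κ * (s / 2) := by
    have : ε ≤ κ * s / (2 * ρ) := (min_le_right _ _).trans (min_le_right _ _)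
    rw [le_div_iff₀ (by positivity)] at this
    linarith
  have hε0 : 0 < ε := by positivity
  by_contra hne
  have hcs : c ∈ ball a s := ball_subset_ball (by linarith) hca
  set t := T c - c with ht
  set τ := ‖t‖ with hτ
  have hτ0 : 0 < τ := norm_pos_iff.2 (sub_ne_zero.2 hne)
  have hτε : τ ≤ ε := hTd c hc hcs
  obtain ⟨u, c', hc', hcc, hμ1, hμ2⟩ := hcut c hc (τ / κ) (by positivity)
    (by rw [div_le_one hκ0]; linarith)
  set d := deriv (S.word u) c' with hd
  set μ := ‖d‖ with hμ
  have hd0 : d ≠ 0 := S.word_deriv_ne u (hA.2.2.1 hc')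
  have hμ0 : 0 < μ := norm_pos_iff.2 hd0
  rw [lt_div_iff₀ hκ0] at hμ2
  have hμ3 : τ ≤ μ * (r / 2) := by
    have : m * τ ≤ μ * κ := by
      calc m * τ = m * (τ / κ) * κ := by field_simp
        _ ≤ μ * κ := by gcongr
    rw [hκ] at this
    have h2 : m * τ ≤ m * (μ * (r / 2)) := by linarith
    exact le_of_mul_le_mul_left h2 hm
  have hμρ : μ * ρ * κ ≤ κ * (s / 2) := by
    calc μ * ρ * κ = (μ * κ) * ρ := by ring
      _ ≤ ε * ρ := by gcongr; linarith
      _ ≤ _ := hε3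
  have hμρ' : μ * ρ ≤ s / 2 := by
    rw [mul_comm κ] at hμρ
    exact le_of_mul_le_mul_right hμρ hκ0
  have hεμ : ε * (μ * ρ) ≤ τ / 2 := by
    calc ε * (μ * ρ) = (ε * ρ) * μ := by ring
      _ ≤ κ / 2 * μ := by gcongr
      _ ≤ τ / 2 := by linarith
  obtain ⟨K, hKA, hpK, hKR, hKc⟩ := hiso c' hc'
  have hKball : ∀ x ∈ K, x ∈ ball c' ρ := by
    intro x hx
    rw [mem_ball, dist_eq_norm]
    linarith [hKR x hx]
  have hc'b : c' ∈ ball c' ρ := mem_ball_self hρ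
  have hKz : ∀ x ∈ K, ‖S.word u x - c‖ < μ * ρ := by
    intro x hx
    have h1 := hG.lin u c' hc' x (hKball x hx) c' hc'b
    rw [hcc] at h1
    have h2 := norm_sub_norm_le (S.word u x - c) (d * (x - c'))
    rw [norm_mul] at h2
    have h3 := hKR x hx
    have h4 : μ * ‖x - c'‖ ≤ μ * (ρ / 2) := by gcongr
    have h5 : 0 < μ * ρ := by positivity
    linarith
  have key : ∀ k : ℕ, ∃ x ∈ K, T^[k] c = S.word u x ∧ ‖T^[k] c - c - k * t‖ ≤ k * (τ / 2) := by
    intro k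
    induction k with
    | zero => exact ⟨c', hpK, hcc.symm, by simp⟩
    | succ k ih =>
      obtain ⟨x, hx, hxe, hxn⟩ := ih
      rw [Function.iterate_succ_apply']
      set z := T^[k] c with hz
      have hzA : z ∈ A := by rw [hxe]; exact hA.word_mem u (hKA hx)
      have hzc : ‖z - c‖ < μ * ρ := by rw [hxe]; exact hKz x hx
      have hzs : z ∈ ball a s := by
        rw [mem_ball] at hca ⊢
        have := dist_triangle z c a
        rw [dist_eq_norm z c] at this
        linarith
      have h1 : ‖(T z - z) - t‖ ≤ τ / 2 := by
        refine (hTl z hzA hzs c hc hcs).trans (le_trans ?_ hεμ)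
        gcongr
      have h2 : ‖T z - z‖ ≤ 3 / 2 * τ := by
        have := norm_sub_norm_le (T z - z) t
        linarith
      have h3 : ‖T z - S.word u x‖ ≤ (1 - 1 / 4) * μ * r := by
        rw [← hxe]
        linarith
      have hcb : closedBall x r ⊆ ball c' ρ := by
        intro y hy
        rw [mem_closedBall] at hy
        have h5 := hKR x hx
        rw [← dist_eq_norm] at h5
        rw [mem_ball]
        have := dist_triangle y x c'
        linarith
      obtain ⟨y, hy, hye⟩ := surj_of_approx hd0 (by norm_num : (0 : ℝ) ≤ 1 / 4)
        (hG.lin u c' hc') hr0.le hcb h3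
      have hyA : y ∈ A := hG.sep u c' hc' y (hcb hy) (by rw [hye]; exact hTA z hzA hzs)
      have hyK : y ∈ K := by
        refine hKc x hx y hyA ?_
        rw [mem_closedBall, dist_comm, dist_eq_norm] at hy
        linarith
      refine ⟨y, hyK, hye.symm, ?_⟩
      calc ‖T z - c - ((k + 1 : ℕ) : ℂ) * t‖ = ‖((T z - z) - t) + (z - c - k * t)‖ := by
            congr 1; push_cast; ring
        _ ≤ τ / 2 + k * (τ / 2) := (norm_add_le _ _).trans (add_le_add h1 hxn)
        _ = ((k + 1 : ℕ) : ℝ) * (τ / 2) := by push_cast; ring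
  obtain ⟨k, hk⟩ := exists_nat_gt (μ * ρ / (τ / 2))
  rw [div_lt_iff₀ (by positivity)] at hk
  obtain ⟨x, hx, hxe, hxn⟩ := key k
  have h1 := hKz x hx
  rw [← hxe] at h1
  have h2 := norm_sub_norm_le ((k : ℂ) * t) (T^[k] c - c)
  rw [norm_sub_rev ((k : ℂ) * t), norm_mul, Complex.norm_natCast] at h2
  rw [← hτ] at h2
  linarith


end HolIFS

/-! ### Renormalised maps -/

theorem totally_bounded_family {ι : Type*} (h : ι → ℂ → ℂ) (a : ℂ) {ρ M : ℝ}
    (hb : ∀ i, ∀ x ∈ ball a ρ, ‖h i x‖ ≤ M)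
    (hl : ∀ i, ∀ x ∈ ball a ρ, ∀ y ∈ ball a ρ, ‖h i x - h i y‖ ≤ ‖x - y‖) {ε : ℝ} (hε : 0 < ε) :
    ∃ J : Set ι, J.Finite ∧ ∀ i, ∃ j ∈ J, ∀ x ∈ ball a ρ, ‖h i x - h j x‖ ≤ ε := by
  have htb : TotallyBounded (ball a ρ) := isBounded_ball.isCompact_closure.totallyBounded.subset subset_closure
  obtain ⟨t, htsub, htf, htc⟩ := htb.exists_subset (dist_mem_uniformity (show 0 < ε / 4 by positivity))
  have : Fintype t := htf.fintype
  let Φ : ι → (t → ℂ) := fun i p => h i p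
  have hΦ : Bornology.IsBounded (range Φ) := by
    rw [isBounded_iff_forall_norm_le]
    refine ⟨|M|, ?_⟩
    rintro _ ⟨i, rfl⟩
    rw [pi_norm_le_iff_of_nonneg (abs_nonneg _)]
    intro p
    exact (hb i p (htsub p.2)).trans (le_abs_self M)
  obtain ⟨t', ht'sub, ht'f, ht'c⟩ :=
    (hΦ.isCompact_closure.totallyBounded.subset subset_closure).exists_subset (dist_mem_uniformity (show 0 < ε / 4 by positivity))
  have hex : ∀ p : t', ∃ i, Φ i = p := fun p => ht'sub p.2
  choose g hg using hex
  have : Finite t' := ht'f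
  refine ⟨range g, finite_range g, fun i => ?_⟩
  obtain ⟨p, hp, hip⟩ := mem_iUnion₂.1 (ht'c (mem_range_self i))
  refine ⟨g ⟨p, hp⟩, mem_range_self _, fun x hx => ?_⟩
  obtain ⟨q, hq, hxq⟩ := mem_iUnion₂.1 (htc hx)
  replace hxq : dist x q < ε / 4 := hxq
  replace hip : dist (Φ i) p < ε / 4 := hip
  rw [show p = Φ (g ⟨p, hp⟩) from (hg ⟨p, hp⟩).symm] at hip
  set j := g ⟨p, hp⟩
  have h1 : dist (h i q) (h j q) < ε / 4 := (dist_le_pi_dist (Φ i) (Φ j) ⟨q, hq⟩).trans_lt hip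
  rw [dist_eq_norm] at h1 hxq
  have h2 := hl i x hx q (htsub hq)
  have h3 := hl j q (htsub hq) x hx
  rw [norm_sub_rev q x] at h3
  calc ‖h i x - h j x‖ = ‖(h i x - h i q) + (h i q - h j q) + (h j q - h j x)‖ := by
        congr 1; ring
    _ ≤ ‖h i x - h i q‖ + ‖h i q - h j q‖ + ‖h j q - h j x‖ := norm_add₃_le
    _ ≤ ε := by linarith

/-- `h = f_v⁻¹ ∘ g_w` near `a`, with controlled size. -/
structure IsGood (G F : HolIFS) (A : Set ℂ) (a : ℂ) (ρ η : ℝ) (w : List (Fin G.m))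
    (v : List (Fin F.m)) (h : ℂ → ℂ) : Prop where
  diff : DifferentiableOn ℂ h (ball a ρ)
  eq : ∀ x ∈ ball a ρ, F.word v (h x) = G.word w x
  mem : ∃ b ∈ A, ∀ x ∈ ball a ρ, h x ∈ ball b ρ
  lin : ∃ l : ℂ, η ≤ ‖l‖ ∧ ‖l‖ ≤ 1 / 4 ∧ ∀ x ∈ ball a ρ, ∀ y ∈ ball a ρ,
    ‖h x - h y - l * (x - y)‖ ≤ 2 / 3 * ‖l‖ * ‖x - y‖

theorem IsGood.lip {G F : HolIFS} {A : Set ℂ} {a : ℂ} {ρ η : ℝ} {w : List (Fin G.m)}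
    {v : List (Fin F.m)} {h : ℂ → ℂ} (H : IsGood G F A a ρ η w v h) :
    ∀ x ∈ ball a ρ, ∀ y ∈ ball a ρ, ‖h x - h y‖ ≤ ‖x - y‖ := by
  intro x hx y hy
  obtain ⟨l, h1, h2, h3⟩ := H.lin
  have h4 := h3 x hx y hy
  have h5 := norm_sub_norm_le (h x - h y) (l * (x - y))
  rw [norm_mul] at h5
  have h6 : ‖l‖ * ‖x - y‖ ≤ 1 / 4 * ‖x - y‖ := by gcongr
  have := norm_nonneg (x - y)
  linarith

theorem exists_good {G F : HolIFS} {A : Set ℂ} (hG : G.IsAttractor A) (hF : F.IsAttractor A) :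
    ∃ η > 0, ∃ m₀ : ℕ, ∀ ρ, G.Geo A ρ → F.Geo A ρ → ∀ a ∈ A, ∀ w : List (Fin G.m),
      m₀ ≤ w.length → w ≠ [] ∧ ∃ v h, v ≠ [] ∧ IsGood G F A a ρ η w v h := by
  obtain ⟨m, hm, hm1, hcut⟩ := hF.cutWord
  have hη : 0 < m / 4 := by positivity
  obtain ⟨m₀, hm₀⟩ := hG.decay (m / 4) hη
  refine ⟨m / 4, hη, m₀ + 1, fun ρ gG gF a ha w hw => ⟨?_, ?_⟩⟩
  · rintro rfl
    simp at hw
  have hd0 : deriv (G.word w) a ≠ 0 := G.word_deriv_ne w (hG.2.2.1 ha)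
  have hdl := hm₀ w (by omega) a ha
  set d := deriv (G.word w) a with hd
  have hdpos : 0 < ‖d‖ := norm_pos_iff.2 hd0
  obtain ⟨v, b, hb, hvb, h1, h2⟩ := hcut (G.word w a) (hG.word_mem w ha) (‖d‖ / (m / 4))
    (by positivity) (by rw [div_le_one hη]; exact hdl.le)
  have hv : v ≠ [] := by
    rintro rfl
    have : ‖deriv (F.word []) b‖ = 1 := by simp [HolIFS.word_nil]
    rw [this, lt_div_iff₀ hη] at h2
    linarith
  have he0 : deriv (F.word v) b ≠ 0 := F.word_deriv_ne v (hF.2.2.1 hb)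
  have hlinF := gF.lin v b hb
  set e := deriv (F.word v) b with he
  have hepos : 0 < ‖e‖ := norm_pos_iff.2 he0
  rw [lt_div_iff₀ hη] at h2
  have h1' : ‖d‖ ≤ 1 / 4 * ‖e‖ := by
    have e1 : m * (‖d‖ / (m / 4)) = 4 * ‖d‖ := by field_simp
    rw [e1] at h1
    linarith
  have hlinG := gG.lin w a ha
  have hρ := gG.pos
  have hex : ∀ x : ℂ, ∃ y, x ∈ ball a ρ → y ∈ closedBall b (ρ / 2) ∧ F.word v y = G.word w x := by
    intro x
    by_cases hx : x ∈ ball a ρ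
    swap
    · exact ⟨0, fun h => (hx h).elim⟩
    obtain ⟨y, hy, hye⟩ := surj_of_approx (z := G.word w x) he0 (by norm_num : (0 : ℝ) ≤ 1 / 4)
      hlinF (half_pos hρ).le (closedBall_subset_ball (by linarith)) (by
        rw [hvb]
        have h3 := hlinG x hx a (mem_ball_self hρ)
        have h4 := norm_sub_norm_le (G.word w x - G.word w a) (d * (x - a))
        rw [norm_mul] at h4
        rw [mem_ball, dist_eq_norm] at hx
        have h5 : ‖d‖ * ‖x - a‖ ≤ 1 / 4 * ‖e‖ * ρ := by gcongr
        have : 0 < ‖e‖ * ρ := by positivity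
        linarith)
    exact ⟨y, fun _ => ⟨hy, hye⟩⟩
  choose h hh using hex
  have hhb : ∀ x ∈ ball a ρ, h x ∈ ball b ρ := fun x hx =>
    closedBall_subset_ball (by linarith) (hh x hx).1
  have hlip : ∀ x ∈ ball a ρ, ∀ y ∈ ball a ρ, ‖e‖ * ‖h x - h y‖ ≤ 5 / 3 * ‖d‖ * ‖x - y‖ := by
    intro x hx y hy
    have a1 := hlinF (h x) (hhb x hx) (h y) (hhb y hy)
    have a2 := hlinG x hx y hy
    rw [(hh x hx).2, (hh y hy).2] at a1
    have a3 := norm_sub_norm_le (G.word w x - G.word w y) (d * (x - y))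
    have a4 := norm_sub_norm_le (e * (h x - h y)) (G.word w x - G.word w y)
    rw [norm_sub_rev (e * (h x - h y)), norm_mul] at a4
    rw [norm_mul] at a3
    linarith
  have hcont : ContinuousOn h (ball a ρ) := by
    refine (LipschitzOnWith.of_dist_le' (K := 1) fun x hx y hy => ?_).continuousOn
    rw [dist_eq_norm, dist_eq_norm, one_mul]
    have a1 := hlip x hx y hy
    have a2 : ‖d‖ * ‖x - y‖ ≤ 1 / 4 * ‖e‖ * ‖x - y‖ := by gcongr
    have a3 : 0 ≤ ‖e‖ * ‖x - y‖ := by positivity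
    have : ‖e‖ * ‖h x - h y‖ ≤ ‖e‖ * ‖x - y‖ := by linarith
    exact le_of_mul_le_mul_left this hepos
  refine ⟨v, h, hv, ?_, fun x hx => (hh x hx).2, ⟨b, hb, hhb⟩, d / e, ?_, ?_, ?_⟩
  · intro x hx
    have hxn : ball a ρ ∈ 𝓝 x := isOpen_ball.mem_nhds hx
    have hΩ : h x ∈ F.Ω := gF.sub b hb (hhb x hx)
    have hstrict : HasStrictDerivAt (F.word v) (deriv (F.word v) (h x)) (h x) :=
      ((F.word_diff v).analyticAt (F.hopen.mem_nhds hΩ)).hasStrictDerivAt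
    have := hasDerivAt_of_comp (hcont.continuousAt hxn) hstrict (F.word_deriv_ne v hΩ)
      (G.word_diffAt w (gG.sub a ha hx)).hasDerivAt (by
        filter_upwards [hxn] with y hy using (hh y hy).2)
    exact this.differentiableAt.differentiableWithinAt
  · rw [norm_div, le_div_iff₀ hepos]
    linarith
  · rw [norm_div, div_le_iff₀ hepos]
    exact h1'
  · intro x hx y hy
    have a1 := hlinF (h x) (hhb x hx) (h y) (hhb y hy)
    have a2 := hlinG x hx y hy
    rw [(hh x hx).2, (hh y hy).2] at a1
    have a5 := hlip x hx y hy
    have a6 : ‖e * (h x - h y) - d * (x - y)‖ ≤ 2 / 3 * ‖d‖ * ‖x - y‖ := by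
      calc ‖e * (h x - h y) - d * (x - y)‖
          = ‖(G.word w x - G.word w y - d * (x - y)) -
              (G.word w x - G.word w y - e * (h x - h y))‖ := by congr 1; ring
        _ ≤ _ := norm_sub_le _ _
        _ ≤ _ := by linarith
    have a7 : e * (h x - h y) - d * (x - y) = e * (h x - h y - d / e * (x - y)) := by
      field_simp
    rw [a7, norm_mul] at a6
    rw [norm_div]
    have a8 : ‖e‖ * (2 / 3 * (‖d‖ / ‖e‖) * ‖x - y‖) = 2 / 3 * ‖d‖ * ‖x - y‖ := by
      field_simp
    rw [← a8] at a6
    exact le_of_mul_le_mul_left a6 hepos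

theorem good_close {G F : HolIFS} {A : Set ℂ} (hG : G.IsAttractor A) (hF : F.IsAttractor A)
    (hnt : A.Nontrivial)
    (hGS : G.SSC A) {ρ η : ℝ} (hη : 0 < η) (gG : G.Geo A ρ) (gF : F.Geo A ρ) :
    ∃ ε₁ > 0, ∀ a ∈ A, ∀ w v h w' v' h', IsGood G F A a ρ η w v h →
      IsGood G F A a ρ η w' v' h' → (∀ x ∈ ball a ρ, ‖h' x - h x‖ ≤ ε₁) →
      ∀ x ∈ ball a ρ, h' x = h x := by
  have hρ := gG.pos
  obtain ⟨ε, hε, hrigid⟩ := hG.rigid hGS (s := ρ / 4) (by positivity)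
  set r := min (ρ / 4) (min ε (ε * ρ / 8)) with hr
  have hr0 : 0 < r := by positivity
  have hr1 : r ≤ ρ / 4 := min_le_left _ _
  have hr2 : r ≤ ε := (min_le_right _ _).trans (min_le_left _ _)
  have hr3 : r ≤ ε * ρ / 8 := (min_le_right _ _).trans (min_le_right _ _)
  refine ⟨1 / 3 * η * r, by positivity, fun a ha w v h w' v' h' H H' hclose => ?_⟩
  obtain ⟨l, hl1, hl2, hlin⟩ := H.lin
  have hl0 : l ≠ 0 := norm_pos_iff.1 (hη.trans_le hl1)
  have hlpos : 0 < ‖l‖ := norm_pos_iff.2 hl0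
  have hsub2 : ball a (ρ / 2) ⊆ ball a ρ := ball_subset_ball (by linarith)
  have hex : ∀ x : ℂ, ∃ y, x ∈ ball a (ρ / 2) → y ∈ closedBall x r ∧ y ∈ ball a ρ ∧ h y = h' x := by
    intro x
    by_cases hx : x ∈ ball a (ρ / 2)
    swap
    · exact ⟨0, fun h => (hx h).elim⟩
    have hcb : closedBall x r ⊆ ball a ρ := by
      intro y hy
      rw [mem_closedBall] at hy
      rw [mem_ball] at hx ⊢
      have := dist_triangle y x a
      linarith
    obtain ⟨y, hy, hye⟩ := surj_of_approx (z := h' x) hl0 (by norm_num : (0 : ℝ) ≤ 2 / 3)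
      hlin hr0.le hcb (by
        refine (hclose x (hsub2 hx)).trans ?_
        have : η * r ≤ ‖l‖ * r := by gcongr
        linarith)
    exact ⟨y, fun _ => ⟨hy, hcb hy, hye⟩⟩
  choose T hT using hex
  have hlow : ∀ x ∈ ball a ρ, ∀ y ∈ ball a ρ, 1 / 3 * ‖l‖ * ‖x - y‖ ≤ ‖h x - h y‖ := by
    intro x hx y hy
    have a1 := hlin x hx y hy
    have a2 := norm_sub_norm_le (l * (x - y)) (h x - h y)
    rw [norm_sub_rev (l * (x - y)), norm_mul] at a2
    linarith
  have hinj : InjOn h (ball a ρ) := by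
    intro x hx y hy hxy
    have := hlow x hx y hy
    rw [hxy, sub_self, norm_zero] at this
    have h2 : ‖x - y‖ ≤ 0 := by
      by_contra hc
      have : 0 < 1 / 3 * ‖l‖ * ‖x - y‖ := by
        have := not_le.1 hc
        positivity
      linarith
    exact sub_eq_zero.1 (norm_le_zero_iff.1 h2)
  have hTc : ContinuousOn T (ball a (ρ / 2)) := by
    refine (LipschitzOnWith.of_dist_le' (K := 3 / ‖l‖) fun x hx y hy => ?_).continuousOn
    rw [dist_eq_norm, dist_eq_norm, div_mul_eq_mul_div, le_div_iff₀ hlpos]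
    have a1 := hlow _ (hT x hx).2.1 _ (hT y hy).2.1
    rw [(hT x hx).2.2, (hT y hy).2.2] at a1
    have a2 := H'.lip x (hsub2 hx) y (hsub2 hy)
    linarith
  have hTd : DifferentiableOn ℂ T (ball a (ρ / 2)) := by
    intro x hx
    have hxn : ball a (ρ / 2) ∈ 𝓝 x := isOpen_ball.mem_nhds hx
    have hTx := (hT x hx).2.1
    have hstrict : HasStrictDerivAt h (deriv h (T x)) (T x) :=
      (H.diff.analyticAt (isOpen_ball.mem_nhds hTx)).hasStrictDerivAt
    have := hasDerivAt_of_comp (hTc.continuousAt hxn) hstrict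
      (injOn_deriv_ne_zero isOpen_ball H.diff hinj hTx)
      (H'.diff.differentiableAt (isOpen_ball.mem_nhds (hsub2 hx))).hasDerivAt (by
        filter_upwards [hxn] with y hy using (hT y hy).2.2)
    exact this.differentiableAt.differentiableWithinAt
  have hφd : DifferentiableOn ℂ (fun x => T x - x) (ball a (ρ / 2)) :=
    hTd.sub differentiableOn_id
  have hφb : ∀ x ∈ ball a (ρ / 2), ‖T x - x‖ ≤ r := by
    intro x hx
    rw [← dist_eq_norm]
    exact (hT x hx).1
  have hsub4 : ball a (ρ / 4) ⊆ ball a (ρ / 2) := ball_subset_ball (by linarith)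
  have hφl : ∀ x ∈ ball a (ρ / 4), ∀ y ∈ ball a (ρ / 4),
      ‖(T x - x) - (T y - y)‖ ≤ ε * ‖x - y‖ := by
    intro x hx y hy
    refine (convex_ball a (ρ / 4)).norm_image_sub_le_of_norm_deriv_le (𝕜 := ℂ)
      (f := fun x => T x - x) (fun u hu => hφd.differentiableAt (isOpen_ball.mem_nhds (hsub4 hu)))
      (fun u hu => ?_) hy hx
    have hcb : closedBall u (ρ / 8) ⊆ ball a (ρ / 2) := by
      intro y hy
      rw [mem_closedBall] at hy
      rw [mem_ball] at hu ⊢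
      have := dist_triangle y u a
      linarith
    have hρ8 : 0 < ρ / 8 := by positivity
    have := Complex.norm_deriv_le_of_forall_mem_sphere_norm_le (f := fun x => T x - x) hρ8
      (hφd.mono (by rwa [closure_ball u hρ8.ne'])).diffContOnCl
      (fun z hz => hφb z (hcb (sphere_subset_closedBall hz)))
    refine this.trans ?_
    rw [div_le_iff₀ hρ8]
    linarith
  have hTA : ∀ x ∈ A, x ∈ ball a (ρ / 4) → T x ∈ A := by
    intro x hxA hx
    have hx2 := hsub4 hx
    obtain ⟨b', hb', hm'⟩ := H'.mem
    have h1 : h' x ∈ A := gF.sep v' b' hb' _ (hm' x (hsub2 hx2)) (by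
      rw [H'.eq x (hsub2 hx2)]; exact hG.word_mem w' hxA)
    refine gG.sep w a ha _ (hT x hx2).2.1 ?_
    rw [← H.eq _ (hT x hx2).2.1, (hT x hx2).2.2]
    exact hF.word_mem v h1
  have hfix := hrigid a ha T hTA (fun x _ hx => (hφb x (hsub4 hx)).trans hr2)
    (fun x _ hx y _ hy => hφl x hx y hy)
  have hfreq : ∃ᶠ z in 𝓝[≠] a, h' z = h z := by
    rw [frequently_iff]
    intro U hU
    obtain ⟨δ, hδ, hδU⟩ := Metric.mem_nhdsWithin_iff.1 hU
    obtain ⟨c, hc, hca, hcd⟩ := hG.perfect hnt ha (ε := min δ (ρ / 8)) (by positivity)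
    rw [← dist_eq_norm] at hcd
    refine ⟨c, hδU ⟨hcd.trans_le (min_le_left _ _), hca⟩, ?_⟩
    have hc8 : c ∈ ball a (ρ / 4 / 2) := by
      rw [mem_ball]
      have := min_le_right δ (ρ / 8)
      linarith
    have hTc := hfix c hc hc8
    have hc2 : c ∈ ball a (ρ / 2) := ball_subset_ball (by linarith) hc8
    rw [← (hT c hc2).2.2, hTc]
  exact AnalyticOnNhd.eqOn_of_preconnected_of_frequently_eq
    (H'.diff.analyticOnNhd isOpen_ball) (H.diff.analyticOnNhd isOpen_ball)
    (convex_ball a ρ).isPreconnected (mem_ball_self hρ) hfreq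


theorem one_side {G F : HolIFS} {A : Set ℂ} (hG : G.IsAttractor A) (hF : F.IsAttractor A)
    (hnt : A.Nontrivial) (hGS : G.SSC A) (hFS : F.SSC A) :
    ∃ ρ₀ > 0, ∀ ρ, 0 < ρ → ρ ≤ ρ₀ → ∀ a ∈ A, ball a ρ ⊆ G.Ω ∧
      ∃ J : Set (List (Fin G.m) × List (Fin F.m)), J.Finite ∧ (∀ p ∈ J, p.1 ≠ [] ∧ p.2 ≠ []) ∧
      ∃ m₀ : ℕ, ∀ w : List (Fin G.m), m₀ ≤ w.length → ∃ v : List (Fin F.m), v ≠ [] ∧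
        ∃ p ∈ J, EqOnSet G F (ball a ρ) p.1 p.2 w v := by
  obtain ⟨r1, hr1, g1⟩ := hG.exists_geo hGS
  obtain ⟨r2, hr2, g2⟩ := hF.exists_geo hFS
  obtain ⟨η, hη, m₀, hgood⟩ := exists_good hG hF
  refine ⟨min r1 r2, by positivity, fun ρ hρ hle a ha => ?_⟩
  have gG := g1 ρ hρ (hle.trans (min_le_left _ _))
  have gF := g2 ρ hρ (hle.trans (min_le_right _ _))
  refine ⟨gG.sub a ha, ?_⟩
  obtain ⟨ε₁, hε₁, hclose⟩ := good_close hG hF hnt hGS hη gG gF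
  obtain ⟨M, hM, hbd⟩ := F.exists_bound
  let I := {t : List (Fin G.m) × List (Fin F.m) × (ℂ → ℂ) //
    t.1 ≠ [] ∧ t.2.1 ≠ [] ∧ IsGood G F A a ρ η t.1 t.2.1 t.2.2}
  have hΩ : ∀ i : I, ∀ x ∈ ball a ρ, i.1.2.2 x ∈ F.Ω := by
    intro i x hx
    obtain ⟨b, hb, hm⟩ := i.2.2.2.mem
    exact gF.sub b hb (hm x hx)
  obtain ⟨J, hJ, hJc⟩ := totally_bounded_family (fun i : I => i.1.2.2) a
    (fun i x hx => hbd _ (hΩ i x hx)) (fun i => i.2.2.2.lip) hε₁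
  refine ⟨(fun i : I => (i.1.1, i.1.2.1)) '' J, hJ.image _, ?_, m₀, ?_⟩
  · rintro _ ⟨i, -, rfl⟩
    exact ⟨i.2.1, i.2.2.1⟩
  · intro w hw
    obtain ⟨hw0, v, h, hv, H⟩ := hgood ρ gG gF a ha w hw
    obtain ⟨j, hj, hjc⟩ := hJc ⟨(w, v, h), hw0, hv, H⟩
    have heq := hclose a ha _ _ _ _ _ _ j.2.2.2 H hjc
    refine ⟨v, hv, _, mem_image_of_mem _ hj, fun x hx => ⟨j.1.2.2 x, hΩ j x hx, ?_, ?_⟩⟩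
    · exact j.2.2.2.eq x hx
    · rw [← heq x hx]
      exact H.eq x hx

theorem both_sides {G F : HolIFS} {A : Set ℂ} (hG : G.IsAttractor A) (hF : F.IsAttractor A)
    (hnt : A.Nontrivial) (hGS : G.SSC A) (hFS : F.SSC A) :
      ∃ (k₀ : ℕ), 1 ≤ k₀ ∧
        ∃ (wk : Fin k₀ → List (Fin G.m)) (vk : Fin k₀ → List (Fin F.m)) (m₀ : ℕ),
          (∀ k, wk k ≠ [] ∧ vk k ≠ []) ∧
          ∃ a ∈ A, ∃ r > (0 : ℝ), Metric.ball a r ⊆ G.Ω ∩ F.Ω ∧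
            GSide G F k₀ wk vk m₀ (Metric.ball a r) ∧
            GSide F G k₀ vk wk m₀ (Metric.ball a r) := by
  obtain ⟨r1, hr1, s1⟩ := one_side hG hF hnt hGS hFS
  obtain ⟨r2, hr2, s2⟩ := one_side hF hG hnt hFS hGS
  obtain ⟨a, ha⟩ := hG.1
  have hρ : 0 < min r1 r2 := by positivity
  obtain ⟨b1, J1, hJ1, hne1, m1, H1⟩ := s1 (min r1 r2) hρ (min_le_left _ _) a ha
  obtain ⟨b2, J2, hJ2, hne2, m2, H2⟩ := s2 (min r1 r2) hρ (min_le_right _ _) a ha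
  obtain ⟨n, f, hf⟩ := (hJ1.union (hJ2.image Prod.swap)).fin_embedding
  have hp : ∀ p ∈ J1 ∪ Prod.swap '' J2, ∃ k, f k = p := by
    intro p hp
    rw [← hf] at hp
    exact hp
  refine ⟨n, ?_, fun k => (f k).1, fun k => (f k).2, max m1 m2, ?_, a, ha, min r1 r2, hρ,
    subset_inter b1 b2, ?_, ?_⟩
  · obtain ⟨v, -, p, hpJ, -⟩ := H1 (List.replicate m1 ⟨0, G.hm⟩) (by simp)
    obtain ⟨k, -⟩ := hp p (Or.inl hpJ)
    exact Nat.succ_le_of_lt (Nat.zero_lt_of_lt k.2)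
  · intro k
    have : f k ∈ J1 ∪ Prod.swap '' J2 := by rw [← hf]; exact mem_range_self k
    rcases this with h | ⟨q, hq, h⟩
    · exact hne1 _ h
    · simp only [← h]
      exact ⟨(hne2 q hq).2, (hne2 q hq).1⟩
  · intro m hm w hw
    obtain ⟨v, hv, p, hpJ, h⟩ := H1 w (by rw [hw]; exact (le_max_left _ _).trans hm)
    obtain ⟨k, rfl⟩ := hp p (Or.inl hpJ)
    exact ⟨v, k, hv, h⟩
  · intro m hm w hw
    obtain ⟨v, hv, p, hpJ, h⟩ := H2 w (by rw [hw]; exact (le_max_right _ _).trans hm)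
    obtain ⟨k, hk⟩ := hp p.swap (Or.inr (mem_image_of_mem _ hpJ))
    refine ⟨v, k, hv, ?_⟩
    simp only [hk]
    exact h

theorem converse_side {G F : HolIFS} {Ag Af : Set ℂ} (hG : G.IsAttractor Ag)
    (hF : F.IsAttractor Af) {k₀ : ℕ} {wk : Fin k₀ → List (Fin G.m)}
    {vk : Fin k₀ → List (Fin F.m)} {m₀ : ℕ} {c : ℂ} {r : ℝ} (hr : 0 < r)
    (hsub : ball c r ⊆ G.Ω) (H : GSide G F k₀ wk vk m₀ (ball c r)) : Ag ⊆ Af := by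
  intro a ha
  rw [← hF.2.1.isClosed.closure_eq, Metric.mem_closure_iff]
  intro ε hε
  obtain ⟨y0, hy0⟩ := hF.1
  have hcB : c ∈ ball c r := mem_ball_self hr
  obtain ⟨c2, hc2B, hc2⟩ : ∃ c2 ∈ ball c r, c2 ≠ c := by
    refine ⟨c + ((r / 2 : ℝ) : ℂ), ?_, ?_⟩
    · rw [mem_ball, dist_eq_norm, add_sub_cancel_left, Complex.norm_real, Real.norm_eq_abs,
        abs_of_pos (by positivity)]
      linarith
    · intro h
      have : ((r / 2 : ℝ) : ℂ) = 0 := by simpa using h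
      rw [Complex.ofReal_eq_zero] at this
      linarith
  have hN : ∀ k, ∃ N : ℕ, ∀ y ∈ F.Ω, F.word (vk k) y = G.word (wk k) c →
      ∀ v : List (Fin F.m), N ≤ v.length → ‖F.word v y - F.word v y0‖ < ε / 2 := by
    intro k
    by_cases hex : ∃ y ∈ F.Ω, F.word (vk k) y = G.word (wk k) c
    · obtain ⟨y, hy, hye⟩ := hex
      obtain ⟨N, hN⟩ := F.contract_pt hy (hF.2.2.1 hy0) (ε / 2) (by positivity)
      refine ⟨N, fun z hz hze v hv => ?_⟩
      rw [F.word_injOn (vk k) hz hy (hze.trans hye.symm)]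
      exact hN v hv
    · exact ⟨0, fun y hy hye => (hex ⟨y, hy, hye⟩).elim⟩
  choose Nk hNk using hN
  set N := Finset.univ.sup Nk with hNdef
  have hη : ∃ η > 0, ∀ k, ∀ v : List (Fin F.m), v.length < N → ∀ y ∈ F.Ω, ∀ y' ∈ F.Ω,
      F.word (vk k) y = G.word (wk k) c → F.word (vk k) y' = G.word (wk k) c2 →
      η ≤ ‖F.word v y - F.word v y'‖ := by
    have h1 : ∀ᶠ η in 𝓝[>] (0 : ℝ), ∀ k, ∀ v ∈ {v : List (Fin F.m) | v.length < N},
        ∀ y ∈ F.Ω, ∀ y' ∈ F.Ω,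
        F.word (vk k) y = G.word (wk k) c → F.word (vk k) y' = G.word (wk k) c2 →
        η ≤ ‖F.word v y - F.word v y'‖ := by
      rw [eventually_all]
      intro k
      rw [eventually_all_finite (List.finite_length_lt _ N)]
      intro v _
      by_cases hex : ∃ y ∈ F.Ω, ∃ y' ∈ F.Ω, F.word (vk k) y = G.word (wk k) c ∧
        F.word (vk k) y' = G.word (wk k) c2
      · obtain ⟨y, hy, y', hy', e, e'⟩ := hex
        have hne : F.word v y ≠ F.word v y' := by
          intro h
          rw [F.word_injOn v hy hy' h, e'] at e
          exact hc2 (G.word_injOn _ (hsub hc2B) (hsub hcB) e)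
        filter_upwards [Ioc_mem_nhdsGT (norm_pos_iff.2 (sub_ne_zero.2 hne))] with η hη
        intro z hz z' hz' ez ez'
        rw [F.word_injOn (vk k) hz hy (ez.trans e.symm),
          F.word_injOn (vk k) hz' hy' (ez'.trans e'.symm)]
        exact hη.2
      · exact Eventually.of_forall fun η y hy y' hy' e e' => (hex ⟨y, hy, y', hy', e, e'⟩).elim
    obtain ⟨η, hη1, hη2⟩ := (h1.and self_mem_nhdsWithin).exists
    exact ⟨η, hη2, hη1⟩
  obtain ⟨η, hη0, hη⟩ := hη
  obtain ⟨N1, hN1⟩ := G.contract_pt (hsub hcB) (hsub hc2B) η hη0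
  obtain ⟨N2, hN2⟩ := G.contract_compact hG.2.1 hG.2.2.1 (hsub hcB) (ε / 2) (by positivity)
  obtain ⟨w, hw, x, hx, hxa⟩ := hG.exists_word (max m₀ (max N1 N2)) ha
  obtain ⟨v, k, -, hE⟩ := H _ (le_max_left _ _) w hw
  obtain ⟨y, hy, e1, e2⟩ := hE c hcB
  obtain ⟨y', hy', e1', e2'⟩ := hE c2 hc2B
  have hlen : N ≤ v.length := by
    by_contra hlt
    have h1 := hη k v (not_le.1 hlt) y hy y' hy' e1 e1'
    rw [e2, e2'] at h1
    have h2 := hN1 w (by rw [hw]; exact (le_max_left _ _).trans (le_max_right _ _))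
    linarith
  refine ⟨F.word v y0, hF.word_mem v hy0, ?_⟩
  have h1 := hNk k y hy e1 v ((Finset.le_sup (Finset.mem_univ k)).trans hlen)
  have h2 := hN2 w (by rw [hw]; exact (le_max_right _ _).trans (le_max_right _ _)) x hx
  rw [hxa, ← dist_eq_norm] at h2
  rw [e2, ← dist_eq_norm] at h1
  have := dist_triangle a (G.word w c) (F.word v y0)
  linarith

/-- Theorem ((I) ⇔ (II)): two holomorphic IFS `G`, `F` with the SSC share the same
attractor iff there are finitely many words `w^k ∈ Λ*`, `v^k ∈ Λ̃*`, `k = 1, …, k₀`, and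
`m₀ ∈ ℕ` such that: for some ball `B_G ⊆ Ω_G`, for every `m ≥ m₀` and every `w ∈ Λ^m`
there are `v ∈ Λ̃*` and `k` with `f_v ∘ f_{v^k}⁻¹ = g_w ∘ g_{w^k}⁻¹` on `g_{w^k}(B_G)`;
and the same with `G` and `F` switched. Moreover, if `A_G = A_F` then the balls
`B_G = B_F` can be chosen equal, a neighborhood of a point of the attractor. -/
theorem stmt_12 (G F : HolIFS) (Ag Af : Set ℂ)
    (hAg : G.IsAttractor Ag) (hAg2 : Ag.Nontrivial) (hSSCg : G.SSC Ag)
    (hAf : F.IsAttractor Af) (hAf2 : Af.Nontrivial) (hSSCf : F.SSC Af) :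
    (Ag = Af ↔
      ∃ (k₀ : ℕ), 1 ≤ k₀ ∧
        ∃ (wk : Fin k₀ → List (Fin G.m)) (vk : Fin k₀ → List (Fin F.m)) (m₀ : ℕ),
          (∀ k, wk k ≠ [] ∧ vk k ≠ []) ∧
          (∃ c : ℂ, ∃ r > (0 : ℝ), Metric.ball c r ⊆ G.Ω ∧
            GSide G F k₀ wk vk m₀ (Metric.ball c r)) ∧
          (∃ c : ℂ, ∃ r > (0 : ℝ), Metric.ball c r ⊆ F.Ω ∧
            GSide F G k₀ vk wk m₀ (Metric.ball c r))) ∧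
    (Ag = Af →
      ∃ (k₀ : ℕ), 1 ≤ k₀ ∧
        ∃ (wk : Fin k₀ → List (Fin G.m)) (vk : Fin k₀ → List (Fin F.m)) (m₀ : ℕ),
          (∀ k, wk k ≠ [] ∧ vk k ≠ []) ∧
          ∃ a ∈ Ag, ∃ r > (0 : ℝ), Metric.ball a r ⊆ G.Ω ∩ F.Ω ∧
            GSide G F k₀ wk vk m₀ (Metric.ball a r) ∧
            GSide F G k₀ vk wk m₀ (Metric.ball a r)) := by
  have key : Ag = Af →
      ∃ (k₀ : ℕ), 1 ≤ k₀ ∧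
        ∃ (wk : Fin k₀ → List (Fin G.m)) (vk : Fin k₀ → List (Fin F.m)) (m₀ : ℕ),
          (∀ k, wk k ≠ [] ∧ vk k ≠ []) ∧
          ∃ a ∈ Ag, ∃ r > (0 : ℝ), Metric.ball a r ⊆ G.Ω ∩ F.Ω ∧
            GSide G F k₀ wk vk m₀ (Metric.ball a r) ∧
            GSide F G k₀ vk wk m₀ (Metric.ball a r) := by
    rintro rfl
    exact both_sides hAg hAf hAg2 hSSCg hSSCf
  refine ⟨⟨fun h => ?_, ?_⟩, key⟩
  · obtain ⟨k₀, hk, wk, vk, m₀, hne, a, -, r, hr, hb, h1, h2⟩ := key h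
    exact ⟨k₀, hk, wk, vk, m₀, hne, ⟨a, r, hr, hb.trans inter_subset_left, h1⟩,
      ⟨a, r, hr, hb.trans inter_subset_right, h2⟩⟩
  · rintro ⟨k₀, -, wk, vk, m₀, -, ⟨c, r, hr, hb, h1⟩, ⟨c', r', hr', hb', h2⟩⟩
    exact Subset.antisymm (converse_side hAg hAf hr hb h1) (converse_side hAf hAg hr' hb' h2)
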